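/- arXiv:2202.10428 — 2 statements merged into one kernel-verified Lean document; each statement's English description precedes it below -/
import Mathlib

section
/- Let A be a unital simple approximately divisible C*-algebra and let p, q be projections in A such that p is Murray–von Neumann equivalent to q and 1−p is Murray–von Neumann equivalent to 1−q. Then there is a norm-continuous path (u_t)_{t∈[0,1]} of unitaries in A such that u_0 = 1 and u_1 p u_1* = q. In particular, p and q are homotopic through projections in A. -/
open Filter Topology

section Defs

variable {A : Type*}

/-- Cuntz subequivalence: `a ≾ b` iff there is a sequence `vₙ` with `‖vₙ * b * vₙ* - a‖ → 0`. -/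
def CuntzLE [NonUnitalCStarAlgebra A] (a b : A) : Prop :=
  ∃ v : ℕ → A, Tendsto (fun n => ‖v n * b * star (v n) - a‖) atTop (𝓝 0)

/-- Cuntz equivalence: `a ∼ b` iff `a ≾ b` and `b ≾ a`. -/
def CuntzEquiv [NonUnitalCStarAlgebra A] (a b : A) : Prop :=
  CuntzLE a b ∧ CuntzLE b a

/-- A projection: a self-adjoint idempotent. -/
def IsProjection [Mul A] [Star A] (p : A) : Prop :=
  IsSelfAdjoint p ∧ p * p = p

/-- Murray–von Neumann equivalence of projections. -/
def MvNEquiv [Mul A] [Star A] (p q : A) : Prop :=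
  ∃ v : A, star v * v = p ∧ v * star v = q

/-- The hereditary subalgebra generated by a positive element `a`: the closure of `a A a`. -/
def her [NonUnitalCStarAlgebra A] (a : A) : Set A :=
  closure {x : A | ∃ y : A, x = a * y * a}

/-- A C*-algebra is simple if its only closed two-sided ideals are `⊥` and `⊤`. -/
def IsSimpleCStarAlgebra (A : Type*) [NonUnitalCStarAlgebra A] : Prop :=
  ∀ I : TwoSidedIdeal A, IsClosed (I : Set A) → I = ⊥ ∨ I = ⊤

/-- A unital C*-algebra is approximately divisible if for each `N ≥ 1` there is an
approximately central sequence of unital `*`-homomorphisms `M_N(ℂ) ⊕ M_{N+1}(ℂ) → A`. -/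
def ApproximatelyDivisible (A : Type*) [CStarAlgebra A] : Prop :=
  ∀ N : ℕ, 0 < N →
    ∃ φ : ℕ → (Matrix (Fin N) (Fin N) ℂ × Matrix (Fin (N + 1)) (Fin (N + 1)) ℂ) →⋆ₐ[ℂ] A,
      ∀ x c, Tendsto (fun n => ‖(φ n) x * c - c * (φ n) x‖) atTop (𝓝 (0 : ℝ))

/-- Real rank zero: every self-adjoint element is a norm limit of self-adjoint elements
with finite spectrum. -/
def RealRankZero (A : Type*) [CStarAlgebra A] : Prop :=
  ∀ a : A, IsSelfAdjoint a → ∀ ε : ℝ, 0 < ε →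
    ∃ b : A, IsSelfAdjoint b ∧ (spectrum ℂ b).Finite ∧ ‖a - b‖ < ε

/-- Stable finiteness: every isometry in every matrix algebra over `A` is a unitary. -/
def StablyFinite (A : Type*) [CStarAlgebra A] : Prop :=
  ∀ n : ℕ, ∀ v : Matrix (Fin n) (Fin n) A, star v * v = 1 → v * star v = 1

/-- A tracial state: a unital positive linear functional satisfying the trace identity. -/
def IsTracialState [CStarAlgebra A] (φ : A →ₗ[ℂ] ℂ) : Prop :=
  φ 1 = 1 ∧ (∀ x : A, ∃ r : ℝ, 0 ≤ r ∧ φ (star x * x) = (r : ℂ)) ∧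
    ∀ x y : A, φ (x * y) = φ (y * x)

/-- The dimension function associated to a tracial state:
`d_τ(a) = lim_{n → ∞} τ(a^{1/n})`. -/
noncomputable def dTau [CStarAlgebra A] (φ : A →ₗ[ℂ] ℂ) (a : A) : ℝ :=
  limUnder atTop (fun n : ℕ => (φ (cfc (fun t : ℝ => t ^ ((n : ℝ)⁻¹)) a)).re)

/-- Strict comparison of positive elements with respect to tracial states. -/
def StrictComparison (A : Type*) [CStarAlgebra A] [PartialOrder A] [StarOrderedRing A] : Prop :=
  ∀ a b : A, 0 ≤ a → 0 ≤ b →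
    (∀ φ : A →ₗ[ℂ] ℂ, IsTracialState φ → dTau φ a < dTau φ b) → CuntzLE a b

end Defs


section Alg
variable {B : Type*} [Ring B]

lemma upath_whitehead (E : Subgroup Bˣ) [E.Normal]
    (hE : ∀ u : Bˣ, ((u : B) - 1) * ((u : B) - 1) = 0 → u ∈ E)
    (α β : B) (hα : α * α = 0) (hβ : β * β = 0) (u : Bˣ) (hu : (u : B) = 1 + α * β) :
    ∃ h : Bˣ, (h : B) = 1 + β * α ∧ u * h⁻¹ ∈ E := by
  let ea : Bˣ := ⟨1 + α, 1 - α, by simp [mul_sub, add_mul, hα], by simp [sub_mul, mul_add, hα]⟩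
  let eb : Bˣ := ⟨1 - β, 1 + β, by simp [sub_mul, mul_add, hβ], by simp [mul_sub, add_mul, hβ]⟩
  have hea : ea ∈ E := hE _ (by simp [ea, hα])
  have heb : eb ∈ E := hE _ (by simp [eb, hβ])
  refine ⟨eb⁻¹ * ea * u * eb * ea⁻¹, ?_, ?_⟩
  · have key : (ea : B) * u * eb = eb * (1 + β * α) * ea := by
      rw [hu]
      change (1 + α) * (1 + α * β) * (1 - β) = (1 - β) * (1 + β * α) * (1 + α)
      have e1 : α * (α * β) = 0 := by rw [← mul_assoc, hα, zero_mul]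
      have e2 : β * (β * α) = 0 := by rw [← mul_assoc, hβ, zero_mul]
      simp only [mul_add, add_mul, mul_sub, sub_mul, mul_one, one_mul, mul_assoc, hα, hβ, e1, e2,
        mul_zero, zero_mul]
      abel
    have : ((eb⁻¹ * ea * u * eb * ea⁻¹ : Bˣ) : B) = (↑eb⁻¹ : B) * ((ea : B) * u * eb) * ↑ea⁻¹ := by
      push_cast; noncomm_ring
    rw [this, key]
    simp [mul_assoc]
  · have : u * (eb⁻¹ * ea * u * eb * ea⁻¹)⁻¹ = (u * (ea * eb⁻¹) * u⁻¹) * (ea⁻¹ * eb) := by group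
    rw [this]
    exact E.mul_mem (Subgroup.Normal.conj_mem inferInstance _ (E.mul_mem hea (E.inv_mem heb)) _)
      (E.mul_mem (E.inv_mem hea) heb)

lemma upath_one (E : Subgroup Bˣ) [E.Normal]
    (hE : ∀ u : Bˣ, ((u : B) - 1) * ((u : B) - 1) = 0 → u ∈ E)
    (p e : B) (hp : p * p = p) (w : Bˣ) {K : ℕ} (a b x x' : Fin K → B)
    (hab : ∑ k, a k * p * b k = 1)
    (hxa : ∀ k l, Commute (x k) (a l)) (hxp : ∀ k, Commute (x k) p)
    (hxb : ∀ k l, Commute (x k) (b l)) (hxw : ∀ k, Commute (x k) w)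
    (hx'b : ∀ k l, Commute (x' k) (b l)) (hx'p : ∀ k, Commute (x' k) p)
    (hxx : ∀ k l, x k * x l = 0) (hxx' : ∀ k l, x' k * x' l = 0)
    (he : ∀ k l, x k * x' l = if k = l then e else 0)
    (u : Bˣ) (hu : (u : B) = 1 + (w - 1) * e) :
    u ∈ E ⊔ (Submonoid.centralizer {p}).units := by
  set y := ∑ k, x k * a k * p with hy
  set z := ∑ k, p * b k * x' k with hz
  have hyz : y * z = e := by
    have : ∀ k l, x k * a k * p * (p * b l * x' l) = if k = l then a k * p * b k * e else 0 := by
      intro k l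
      calc x k * a k * p * (p * b l * x' l) = (x k * (a k * (p * p) * b l)) * x' l := by
            noncomm_ring
        _ = a k * p * b l * (x k * x' l) := by
            rw [hp, (((hxa k k).mul_right (hxp k)).mul_right (hxb k l)).eq]; noncomm_ring
        _ = _ := by
            rw [he]; split_ifs with h
            · rw [h]
            · simp
    simp only [hy, hz, Finset.sum_mul_sum, this]
    simp [← Finset.sum_mul, hab]
  have hywy : y * ((w : B) - 1) * y = 0 := by
    rw [hy, Finset.sum_mul, Finset.sum_mul]
    refine Finset.sum_eq_zero fun k _ => ?_
    rw [Finset.mul_sum]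
    refine Finset.sum_eq_zero fun l _ => ?_
    have h : Commute (x l) (a k * p * ((w : B) - 1)) :=
      ((hxa l k).mul_right (hxp l)).mul_right ((hxw l).sub_right (Commute.one_right _))
    calc x k * a k * p * ((w : B) - 1) * (x l * a l * p)
        = x k * ((a k * p * ((w : B) - 1)) * x l) * a l * p := by noncomm_ring
      _ = (x k * x l) * (a k * p * ((w : B) - 1)) * a l * p := by rw [← h.eq]; noncomm_ring
      _ = 0 := by rw [hxx]; simp
  have hzz : z * z = 0 := by
    rw [hz, Finset.sum_mul_sum]
    refine Finset.sum_eq_zero fun k _ => Finset.sum_eq_zero fun l _ => ?_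
    calc p * b k * x' k * (p * b l * x' l) = p * b k * (x' k * (p * b l)) * x' l := by noncomm_ring
      _ = p * b k * (p * b l) * (x' k * x' l) := by
          rw [((hx'p k).mul_right (hx'b k l)).eq]; noncomm_ring
      _ = 0 := by rw [hxx']; simp
  obtain ⟨h, hh, hE'⟩ := upath_whitehead E hE (((w : B) - 1) * y) z
    (by rw [mul_assoc, ← mul_assoc y, hywy, mul_zero]) hzz u (by rw [hu, mul_assoc, hyz])
  have hpz : p * z = z := by
    simp only [hz, Finset.mul_sum, ← mul_assoc, hp]
  have hyp : y * p = y := by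
    simp only [hy, Finset.sum_mul, mul_assoc, hp]
  have hpy' : z * p = p * z * p := by rw [hpz]
  have hzp : ∀ c, p * (z * (c * y)) = z * (c * y) * p := by
    intro c
    rw [← mul_assoc, hpz, mul_assoc, mul_assoc, hyp]
  have hc : h ∈ (Submonoid.centralizer {p}).units := by
    have hcm : Commute p (h : B) := by
      rw [hh]; exact (Commute.one_right _).add_right (hzp _)
    rw [Submonoid.mem_units_iff]
    constructor
    · simpa [Submonoid.mem_centralizer_iff] using hcm.eq
    · simpa [Submonoid.mem_centralizer_iff] using hcm.units_inv_right.eq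
  have : u = u * h⁻¹ * h := by group
  rw [this]
  exact Subgroup.mul_mem_sup hE' hc

lemma upath_sum (H : Subgroup Bˣ) (w : Bˣ) {ι : Type*} [DecidableEq ι] (e : ι → B)
    (hew : ∀ i, Commute (e i) w) (hee : ∀ i j, e i * e j = if i = j then e i else 0)
    (h1 : ∀ i, ∀ u : Bˣ, (u : B) = 1 + (w - 1) * e i → u ∈ H) (s : Finset ι) :
    ∀ u : Bˣ, (u : B) = 1 + (w - 1) * ∑ i ∈ s, e i → u ∈ H := by
  induction s using Finset.induction_on with
  | empty => intro u hu; have : u = 1 := by ext; simpa using hu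
             rw [this]; exact H.one_mem
  | insert i s hi ih =>
    intro u hu
    have hii : e i * e i = e i := by simp [hee]
    have hcw : ∀ c d: B, Commute (e i) d → (c * e i) * (d * e i) = c * d * e i := by
      intro c d hd
      calc (c * e i) * (d * e i) = c * (e i * d) * e i := by noncomm_ring
        _ = c * d * (e i * e i) := by rw [hd.eq]; noncomm_ring
        _ = _ := by rw [hii]
    have c1 : Commute (e i) ((w : B) - 1) := (hew i).sub_right (Commute.one_right _)
    have c2 : Commute (e i) ((↑w⁻¹ : B) - 1) :=
      ((hew i).units_inv_right).sub_right (Commute.one_right _)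
    have aux : ∀ c d : B, (c+1) * (d+1) = 1 → Commute (e i) d →
        (1 + c * e i) * (1 + d * e i) = 1 := by
      intro c d h hd
      have : (1 + c * e i) * (1 + d * e i) = 1 + ((c+1) * (d+1) - 1) * e i := by
        rw [mul_add, add_mul, add_mul, hcw c d hd]; noncomm_ring
      rw [this, h]; simp
    let ω : Bˣ := ⟨1 + (w - 1) * e i, 1 + (↑w⁻¹ - 1) * e i, aux _ _ (by simp) c2,
      aux _ _ (by simp) c1⟩
    have hω : ω ∈ H := h1 i ω rfl
    have : u = ω * (ω⁻¹ * u) := by group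
    rw [this]
    refine H.mul_mem hω (ih _ ?_)
    rw [Units.val_mul, Units.inv_mul_eq_iff_eq_mul, hu, Finset.sum_insert hi]
    change _ = (1 + (w - 1) * e i) * _
    have h0 : e i * ∑ j ∈ s, e j = 0 := by
      rw [Finset.mul_sum]
      refine Finset.sum_eq_zero fun j hj => ?_
      rw [hee, if_neg]; rintro rfl; exact hi hj
    have h0' : ((w : B) - 1) * e i * ((w - 1) * ∑ j ∈ s, e j) = 0 := by
      calc _ = ((w : B) - 1) * (e i * (w - 1)) * ∑ j ∈ s, e j := by noncomm_ring
        _ = ((w : B) - 1) * (w - 1) * (e i * ∑ j ∈ s, e j) := by rw [c1.eq]; noncomm_ring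
        _ = 0 := by rw [h0, mul_zero]
    rw [add_mul, mul_add (((w : B) - 1) * e i), h0']
    noncomm_ring

lemma upath_D (E : Subgroup Bˣ) [E.Normal]
    (hE : ∀ u : Bˣ, ((u : B) - 1) * ((u : B) - 1) = 0 → u ∈ E)
    (p : B) (hp : p * p = p) (w : Bˣ) {K : ℕ} (a b : Fin K → B)
    (hab : ∑ k, a k * p * b k = 1)
    (ψ : (Matrix (Fin (K + 1)) (Fin (K + 1)) ℂ × Matrix (Fin (K + 1 + 1)) (Fin (K + 1 + 1)) ℂ)
      →+* B)
    (ha : ∀ d k, Commute (ψ d) (a k)) (hb : ∀ d k, Commute (ψ d) (b k))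
    (hpc : ∀ d, Commute (ψ d) p) (hw : ∀ d, Commute (ψ d) w) :
    w ∈ E ⊔ (Submonoid.centralizer {p}).units := by
  let f : Fin (K + 1) ⊕ Fin (K + 1 + 1) →
    (Matrix (Fin (K + 1)) (Fin (K + 1)) ℂ × Matrix (Fin (K + 1 + 1)) (Fin (K + 1 + 1)) ℂ) :=
    Sum.elim (fun i => (Matrix.single i i 1, 0)) (fun i => (0, Matrix.single i i 1))
  have hf1 : ∑ i, f i = 1 := by
    rw [Fintype.sum_sum_type]
    refine Prod.ext ?_ ?_
    · simp only [f, Sum.elim_inl, Sum.elim_inr, Prod.fst_add, Prod.fst_sum, Prod.fst_one,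
        Finset.sum_const_zero, add_zero]
      exact Matrix.sum_single_one
    · simp only [f, Sum.elim_inl, Sum.elim_inr, Prod.snd_add, Prod.snd_sum, Prod.snd_one,
        Finset.sum_const_zero, zero_add]
      exact Matrix.sum_single_one
  have hψ0 : ψ (0, 0) = 0 := map_zero ψ
  refine upath_sum _ w (fun i => ψ (f i)) (fun i => hw _) ?_ ?_ Finset.univ w ?_
  · rintro (i | i) (j | j) <;> rw [← map_mul]
    · by_cases h : i = j
      · subst h; simp [f]
      · simp [f, h, hψ0]
    · simp [f, hψ0]
    · simp [f, hψ0]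
    · by_cases h : i = j
      · subst h; simp [f]
      · simp [f, h, hψ0]
  · rintro (i | i) u hu
    · refine upath_one E hE p _ hp w a b
        (fun k => ψ (Matrix.single i (i.succAbove k) 1, 0))
        (fun k => ψ (Matrix.single (i.succAbove k) i 1, 0)) hab
        (fun _ _ => ha _ _) (fun _ => hpc _) (fun _ _ => hb _ _) (fun _ => hw _)
        (fun _ _ => hb _ _) (fun _ => hpc _) ?_ ?_ ?_ u hu <;> intro k l <;> rw [← map_mul]
      · simp [Fin.succAbove_ne, hψ0]
      · simp [(Fin.succAbove_ne _ _).symm, hψ0]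
      · by_cases h : k = l
        · subst h; simp [f]
        · simp [h, hψ0]
    · have hne : ∀ k : Fin K, i.succAbove k.castSucc ≠ i := fun k => Fin.succAbove_ne _ _
      refine upath_one E hE p _ hp w a b
        (fun k => ψ (0, Matrix.single i (i.succAbove k.castSucc) 1))
        (fun k => ψ (0, Matrix.single (i.succAbove k.castSucc) i 1)) hab
        (fun _ _ => ha _ _) (fun _ => hpc _) (fun _ _ => hb _ _) (fun _ => hw _)
        (fun _ _ => hb _ _) (fun _ => hpc _) ?_ ?_ ?_ u hu <;> intro k l <;> rw [← map_mul]
      · simp [hne, hψ0]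
      · simp [(hne _).symm, hψ0]
      · by_cases h : k = l
        · subst h; simp [f]
        · simp [h, hψ0]
  · rw [← map_sum, hf1]; simp
end Alg
set_option linter.unusedSectionVars false

section Seq
open BoundedContinuousFunction
variable {A : Type*} [NormedRing A]

/-- Null sequences in the algebra of bounded sequences. -/
def upathNull (A : Type*) [NormedRing A] : Ideal (ℕ →ᵇ A) where
  carrier := {f | Tendsto (fun n => ‖f n‖) atTop (𝓝 0)}
  zero_mem' := by simp
  add_mem' := by
    intro f g hf hg
    simp only [Set.mem_ofPred_eq, ← tendsto_zero_iff_norm_tendsto_zero] at *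
    rw [show (0:A) = 0 + 0 by simp]
    exact hf.add hg
  smul_mem' := by
    intro c f hf
    simp only [Set.mem_ofPred_eq] at *
    have h2 : Tendsto (fun n => ‖c‖ * ‖f n‖) atTop (𝓝 0) := by simpa using hf.const_mul ‖c‖
    refine squeeze_zero (fun n => norm_nonneg _) (fun n => ?_) h2
    exact (norm_mul_le _ _).trans (by gcongr; exact c.norm_coe_le_norm n)

lemma upathNull_mem (f : ℕ →ᵇ A) : f ∈ upathNull A ↔ Tendsto (fun n => ‖f n‖) atTop (𝓝 0) :=
  Iff.rfl

instance upathNull_twoSided : (upathNull A).IsTwoSided where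
  mul_mem_of_left := by
    intro f c hf
    rw [upathNull_mem] at *
    have h2 : Tendsto (fun n => ‖f n‖ * ‖c‖) atTop (𝓝 0) := by simpa using hf.mul_const ‖c‖
    refine squeeze_zero (fun n => norm_nonneg _) (fun n => ?_) h2
    exact (norm_mul_le _ _).trans (by gcongr; exact c.norm_coe_le_norm n)

/-- Asymptotic sequence algebra (as a ring). -/
abbrev UpathB (A : Type*) [NormedRing A] := (ℕ →ᵇ A) ⧸ upathNull A

/-- Quotient map. -/
noncomputable abbrev upathMk (A : Type*) [NormedRing A] : (ℕ →ᵇ A) →+* UpathB A := Ideal.Quotient.mk (upathNull A)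

lemma upathMk_eq (f g : ℕ →ᵇ A) :
    upathMk A f = upathMk A g ↔ Tendsto (fun n => ‖f n - g n‖) atTop (𝓝 0) := by
  rw [Ideal.Quotient.mk_eq_mk_iff_sub_mem, upathNull_mem]; rfl

lemma upathMk_surj (x : UpathB A) : ∃ f, upathMk A f = x := Ideal.Quotient.mk_surjective x

/-- constants -/
def upathConst (A : Type*) [NormedRing A] : A →+* (ℕ →ᵇ A) where
  toFun a := BoundedContinuousFunction.const ℕ a
  map_one' := rfl
  map_zero' := rfl
  map_add' _ _ := rfl
  map_mul' _ _ := rfl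

variable [CompleteSpace A]

lemma upath_isUnit {a y : A} (h1 : ‖a * y - 1‖ < 1) (h2 : ‖y * a - 1‖ < 1) : IsUnit a := by
  have k1 : IsUnit (a * y) := by
    have := (Units.oneSub (1 - a * y) (by rwa [norm_sub_rev])).isUnit
    simpa using this
  have k2 : IsUnit (y * a) := by
    have := (Units.oneSub (1 - y * a) (by rwa [norm_sub_rev])).isUnit
    simpa using this
  obtain ⟨s, hs⟩ := k1
  obtain ⟨t, ht⟩ := k2
  rw [isUnit_iff_exists_and_exists]
  refine ⟨⟨y * ↑s⁻¹, by rw [← mul_assoc, ← hs]; simp⟩, ⟨↑t⁻¹ * y, by rw [mul_assoc, ← ht]; simp⟩⟩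

variable [NormedAlgebra ℂ A]

lemma upath_joined {a a' y : A} (h1 : ‖a * y - 1‖ < 1) (h2 : ‖y * a - 1‖ < 1)
    (h1' : ‖a' * y - 1‖ < 1) (h2' : ‖y * a' - 1‖ < 1) : JoinedIn {a : A | IsUnit a} a a' := by
  let : NormedSpace ℝ A := NormedSpace.restrictScalars ℝ ℂ A
  refine JoinedIn.ofLine (f := fun t : ℝ => a + (t : ℂ) • (a' - a)) (by fun_prop) (by simp) (by simp) ?_
  rintro _ ⟨t, ht, rfl⟩
  have key : ∀ c d : A, ‖c‖ < 1 → ‖d‖ < 1 → ‖((1 - t : ℝ) : ℂ) • c + (t : ℂ) • d‖ < 1 := by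
    intro c d hc hd
    calc _ ≤ ‖((1 - t : ℝ) : ℂ) • c‖ + ‖(t : ℂ) • d‖ := norm_add_le _ _
      _ = (1 - t) * ‖c‖ + t * ‖d‖ := by
        rw [norm_smul, norm_smul, Complex.norm_real, Complex.norm_real, Real.norm_of_nonneg,
          Real.norm_of_nonneg ht.1]
        linarith [ht.2]
      _ < 1 := by
        rcases eq_or_lt_of_le ht.1 with h | h
        · rw [← h]; simpa using hc
        · nlinarith [ht.2, ht.1]
  refine upath_isUnit (y := y) ?_ ?_
  · convert key _ _ h1 h1' using 2
    simp only [add_mul, smul_sub, sub_mul, smul_mul_assoc]; push_cast; module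
  · convert key _ _ h2 h2' using 2
    simp only [mul_add, smul_sub, mul_sub, mul_smul_comm]; push_cast; module

/-- elements joined to one through invertibles -/
def upathGL0 (A : Type*) [NormedRing A] : Set A := {a | JoinedIn {a : A | IsUnit a} 1 a}

lemma upathGL0_mul {a b : A} (ha : a ∈ upathGL0 A) (hb : b ∈ upathGL0 A) : a * b ∈ upathGL0 A := by
  have := JoinedIn.mul ha hb
  rw [one_mul] at this
  refine this.mono ?_
  rintro _ ⟨x, hx, y, hy, rfl⟩
  exact IsUnit.mul hx hy

lemma upathGL0_inv {a : Aˣ} (ha : (a : A) ∈ upathGL0 A) : ((a⁻¹ : Aˣ) : A) ∈ upathGL0 A := by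
  have h : JoinedIn {a : A | IsUnit a} (1 : A) a := ha
  have h2 := h.map (f := fun x => ((a⁻¹ : Aˣ) : A) * x) (by fun_prop)
  simp only [mul_one, Units.inv_mul] at h2
  refine (h2.mono ?_).symm
  rintro _ ⟨x, hx, rfl⟩
  exact IsUnit.mul (Units.isUnit _) hx

lemma upathGL0_conj {a : A} (u : Aˣ) (ha : a ∈ upathGL0 A) :
    (u : A) * a * ((u⁻¹ : Aˣ) : A) ∈ upathGL0 A := by
  have h : JoinedIn {a : A | IsUnit a} (1 : A) a := ha
  have h2 := h.map (f := fun x => (u : A) * x * ((u⁻¹ : Aˣ) : A)) (by fun_prop)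
  simp only [mul_one, Units.mul_inv] at h2
  refine h2.mono ?_
  rintro _ ⟨x, hx, rfl⟩
  exact IsUnit.mul (IsUnit.mul (Units.isUnit _) hx) (Units.isUnit _)

lemma upath_ev {f g : ℕ →ᵇ A} (h : upathMk A f * upathMk A g = 1) :
    ∀ᶠ n in atTop, ‖f n * g n - 1‖ < 1 := by
  rw [← map_mul, ← map_one (upathMk A), upathMk_eq] at h
  exact h.eventually_lt_const one_pos

/-- All lifts of `u` are eventually in `GL₀`; it suffices to check one lift. -/
lemma upath_lift_indep (u : (UpathB A)ˣ) (f g : ℕ →ᵇ A) (hf : upathMk A f = u)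
    (hg : upathMk A g = u) (h : ∀ᶠ n in atTop, f n ∈ upathGL0 A) :
    ∀ᶠ n in atTop, g n ∈ upathGL0 A := by
  obtain ⟨y, hy⟩ := upathMk_surj (↑u⁻¹ : UpathB A)
  have e1 := upath_ev (f := f) (g := y) (by rw [hf, hy]; simp)
  have e2 := upath_ev (f := y) (g := f) (by rw [hf, hy]; simp)
  have e3 := upath_ev (f := g) (g := y) (by rw [hg, hy]; simp)
  have e4 := upath_ev (f := y) (g := g) (by rw [hg, hy]; simp)
  filter_upwards [h, e1, e2, e3, e4] with n h e1 e2 e3 e4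
  exact JoinedIn.trans h (upath_joined e1 e2 e3 e4)

/-- The units of the sequence algebra which lift to `GL₀`. -/
def upathP (A : Type*) [NormedRing A] [CompleteSpace A] [NormedAlgebra ℂ A] :
    Subgroup (UpathB A)ˣ where
  carrier := {u | ∀ f, upathMk A f = u → ∀ᶠ n in atTop, f n ∈ upathGL0 A}
  one_mem' := by
    intro f hf
    refine upath_lift_indep 1 1 f (by simp) hf (Eventually.of_forall fun n => ?_)
    exact JoinedIn.refl isUnit_one
  mul_mem' := by
    intro u v hu hv f hf
    obtain ⟨x, hx⟩ := upathMk_surj (u : UpathB A)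
    obtain ⟨y, hy⟩ := upathMk_surj (v : UpathB A)
    refine upath_lift_indep (u * v) (x * y) f (by simp [hx, hy]) hf ?_
    filter_upwards [hu x hx, hv y hy] with n h1 h2
    exact upathGL0_mul h1 h2
  inv_mem' := by
    intro u hu y hy
    obtain ⟨x, hx⟩ := upathMk_surj (u : UpathB A)
    have e1 := upath_ev (f := x) (g := y) (by rw [hx, hy]; simp)
    have e2 := upath_ev (f := y) (g := x) (by rw [hx, hy]; simp)
    filter_upwards [hu x hx, e1, e2] with n h1 e1 e2
    obtain ⟨v, hv⟩ := h1.target_mem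
    have h3 : ((v⁻¹ : Aˣ) : A) ∈ upathGL0 A := upathGL0_inv (by rw [hv]; exact h1)
    refine JoinedIn.trans h3 (upath_joined (y := x n) ?_ ?_ e2 e1)
    · rw [← hv]; simp
    · rw [← hv]; simp

instance upathP_normal : (upathP A).Normal where
  conj_mem := by
    intro u hu g f hf
    obtain ⟨x, hx⟩ := upathMk_surj (g : UpathB A)
    obtain ⟨y, hy⟩ := upathMk_surj (↑g⁻¹ : UpathB A)
    obtain ⟨c, hc⟩ := upathMk_surj (u : UpathB A)
    refine upath_lift_indep (g * u * g⁻¹) (x * c * y) f (by simp [hx, hy, hc]) hf ?_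
    have e1 := upath_ev (f := x) (g := y) (by rw [hx, hy]; simp)
    have e2 := upath_ev (f := y) (g := x) (by rw [hx, hy]; simp)
    filter_upwards [hu c hc, e1, e2] with n h1 e1 e2
    obtain ⟨v, hv⟩ := upath_isUnit e1 e2
    have h3 := upathGL0_conj v h1
    have h4 : JoinedIn {a : A | IsUnit a} ((v⁻¹ : Aˣ) : A) (y n) :=
      upath_joined (y := x n) (by rw [← hv]; simp) (by rw [← hv]; simp) e2 e1
    have h5 := h4.map (f := fun t => (v : A) * c n * t) (by fun_prop)
    refine JoinedIn.trans h3 ?_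
    rw [hv] at h5 ⊢
    refine h5.mono ?_
    rintro _ ⟨t, ht, rfl⟩
    exact IsUnit.mul (IsUnit.mul (hv ▸ v.isUnit) h1.target_mem) ht

lemma upathP_nil (u : (UpathB A)ˣ) (h : ((u : UpathB A) - 1) * ((u : UpathB A) - 1) = 0) :
    u ∈ upathP A := by
  intro f hf
  have h0 : upathMk A ((f - 1) * (f - 1)) = upathMk A 0 := by simp [hf, h]
  rw [upathMk_eq] at h0
  filter_upwards [h0.eventually_lt_const one_pos] with n hn
  simp only [coe_mul, coe_sub, coe_one, Pi.mul_apply, Pi.sub_apply, Pi.one_apply, coe_zero,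
    Pi.zero_apply, sub_zero] at hn
  refine JoinedIn.ofLine (f := fun t : ℝ => 1 + (t : ℂ) • (f n - 1)) (by fun_prop) (by simp)
    (by simp) ?_
  rintro _ ⟨t, ht, rfl⟩
  have key : ‖-(((t * t : ℝ) : ℂ) • ((f n - 1) * (f n - 1)))‖ < 1 := by
    rw [norm_neg, norm_smul, Complex.norm_real, Real.norm_of_nonneg (mul_self_nonneg t)]
    have : t * t ≤ 1 := by nlinarith [ht.1, ht.2]
    nlinarith [norm_nonneg ((f n - 1) * (f n - 1)), mul_self_nonneg t]
  refine upath_isUnit (y := 1 - (t : ℂ) • (f n - 1)) ?_ ?_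
  · convert key using 2
    simp only [add_mul, mul_sub, one_mul, mul_one, smul_mul_assoc, mul_smul_comm, smul_smul, smul_sub, sub_mul]
    push_cast; module
  · convert key using 2
    simp only [mul_add, mul_sub, one_mul, mul_one, smul_mul_assoc, mul_smul_comm, smul_smul, smul_sub, sub_mul]
    push_cast; module
end Seq

section Full

lemma upath_full {A : Type*} [CStarAlgebra A]
    (hsimple : ∀ I : TwoSidedIdeal A, IsClosed (I : Set A) → I = ⊥ ∨ I = ⊤)
    (p : A) (hp : p ≠ 0) : ∃ (K : ℕ) (a b : Fin K → A), ∑ k, a k * p * b k = 1 := by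
  let S : AddSubgroup A := AddSubgroup.closure {x | ∃ a b, x = a * p * b}
  have hSl : ∀ c, ∀ x ∈ S, c * x ∈ S := by
    intro c x hx
    induction hx using AddSubgroup.closure_induction with
    | mem x hx => obtain ⟨a, b, rfl⟩ := hx
                  exact AddSubgroup.subset_closure ⟨c * a, b, by simp [mul_assoc]⟩
    | zero => simpa using S.zero_mem
    | add x y _ _ h1 h2 => rw [mul_add]; exact S.add_mem h1 h2
    | neg x _ h => rw [mul_neg]; exact S.neg_mem h
  have hSr : ∀ c, ∀ x ∈ S, x * c ∈ S := by
    intro c x hx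
    induction hx using AddSubgroup.closure_induction with
    | mem x hx => obtain ⟨a, b, rfl⟩ := hx
                  exact AddSubgroup.subset_closure ⟨a, b * c, by simp [mul_assoc]⟩
    | zero => simpa using S.zero_mem
    | add x y _ _ h1 h2 => rw [add_mul]; exact S.add_mem h1 h2
    | neg x _ h => rw [neg_mul]; exact S.neg_mem h
  let T := S.topologicalClosure
  let I : TwoSidedIdeal A := TwoSidedIdeal.mk' (T : Set A) T.zero_mem (T.add_mem) (T.neg_mem)
    (by
      intro c x hx
      exact map_mem_closure (f := fun x => c * x) (by fun_prop) hx (fun x hx => hSl c x hx))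
    (by
      intro x c hx
      exact map_mem_closure (f := fun x => x * c) (by fun_prop) hx (fun x hx => hSr c x hx))
  have hI : (I : Set A) = T := TwoSidedIdeal.coe_mk' _ _ _ _ _ _
  have hpS : p ∈ S := AddSubgroup.subset_closure ⟨1, 1, by simp⟩
  have htop : I = ⊤ := by
    rcases hsimple I (by rw [hI]; exact S.isClosed_topologicalClosure) with h | h
    · exfalso
      have : p ∈ (I : Set A) := by rw [hI]; exact S.le_topologicalClosure hpS
      rw [h] at this
      exact hp (by simpa using this)
    · exact h
  have h1 : (1 : A) ∈ closure (S : Set A) := by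
    have : (1 : A) ∈ (I : Set A) := by rw [htop]; trivial
    rwa [hI] at this
  obtain ⟨x, hx, hxS⟩ := mem_closure_iff.mp h1 {x | IsUnit x} Units.isOpen isUnit_one
  obtain ⟨v, rfl⟩ := hx
  have h1S : (1 : A) ∈ S := by
    have := hSl (↑v⁻¹) _ hxS
    simpa using this
  have : ∀ x ∈ S, ∃ (K : ℕ) (a b : Fin K → A), ∑ k, a k * p * b k = x := by
    intro x hx
    induction hx using AddSubgroup.closure_induction with
    | mem x hx => obtain ⟨a, b, rfl⟩ := hx
                  exact ⟨1, fun _ => a, fun _ => b, by simp⟩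
    | zero => exact ⟨0, fun _ => 0, fun _ => 0, by simp⟩
    | add x y _ _ h1 h2 =>
      obtain ⟨K, a, b, rfl⟩ := h1
      obtain ⟨L, c, d, rfl⟩ := h2
      exact ⟨K + L, Fin.append a c, Fin.append b d, by simp [Fin.sum_univ_add]⟩
    | neg x _ h =>
      obtain ⟨K, a, b, rfl⟩ := h
      exact ⟨K, -a, b, by simp⟩
  exact this 1 h1S
end Full

section Polar
variable {A : Type*} [CStarAlgebra A]

/-- The inverse absolute value. -/
noncomputable def upathAbsInv (a : A) : A := cfc (fun x : ℝ => (√x)⁻¹) (star a * a)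

lemma upath_spec {a : A} (ha : IsUnit a) {x : ℝ} (hx : x ∈ spectrum ℝ (star a * a)) : 0 < x := by
  let := CStarAlgebra.spectralOrder A
  let := CStarAlgebra.spectralOrderedRing A
  have h0 : 0 ≤ x := spectrum_nonneg_of_nonneg (star_mul_self_nonneg a) hx
  refine lt_of_le_of_ne h0 ?_
  rintro rfl
  exact spectrum.zero_notMem ℝ (ha.star.mul ha) hx

lemma upath_polar_unitary {a : A} (ha : IsUnit a) : a * upathAbsInv a ∈ unitary A := by
  have hsa : IsSelfAdjoint (star a * a) := IsSelfAdjoint.star_mul_self a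
  have hc : ContinuousOn (fun x : ℝ => (√x)⁻¹) (spectrum ℝ (star a * a)) := by
    refine ContinuousOn.inv₀ (by fun_prop) fun x hx => ?_
    exact (Real.sqrt_pos.mpr (upath_spec ha hx)).ne'
  have hbs : IsSelfAdjoint (upathAbsInv a) := cfc_predicate _ _
  have h1 : star (a * upathAbsInv a) * (a * upathAbsInv a) = 1 := by
    rw [star_mul, hbs.star_eq]
    have : upathAbsInv a * star a * (a * upathAbsInv a)
        = upathAbsInv a * (star a * a) * upathAbsInv a := by noncomm_ring
    rw [this]
    have h2 : (star a * a) = cfc (fun x : ℝ => x) (star a * a) := (cfc_id' ℝ (star a * a)).symm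
    unfold upathAbsInv
    conv_lhs => enter [1, 2]; rw [h2]
    rw [← cfc_mul (fun x : ℝ => (√x)⁻¹) (fun x => x) (star a * a) hc (by fun_prop),
      ← cfc_mul (fun x : ℝ => (√x)⁻¹ * x) (fun x : ℝ => (√x)⁻¹) (star a * a)
        (hc.mul (by fun_prop)) hc]
    rw [← cfc_one ℝ (star a * a)]
    refine cfc_congr fun x hx => ?_
    have hx := upath_spec ha hx
    have := Real.sqrt_pos.mpr hx
    simp only [Pi.one_apply]
    field_simp
    rw [Real.sq_sqrt hx.le]
  have hu : IsUnit (a * upathAbsInv a) := by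
    refine ha.mul ?_
    unfold upathAbsInv
    rw [isUnit_cfc_iff _ _ hc]
    intro x hx
    exact inv_ne_zero (Real.sqrt_pos.mpr (upath_spec ha hx)).ne'
  refine ⟨h1, ?_⟩
  obtain ⟨v, hv⟩ := hu
  rw [← hv] at h1 ⊢
  have : star (v : A) = ↑v⁻¹ := (Units.inv_eq_of_mul_eq_one_left h1).symm
  rw [this]; simp

lemma upath_polar_cont {s : Set ℝ} {a : ℝ → A} (ha : ContinuousOn a s)
    (hu : ∀ t ∈ s, IsUnit (a t)) : ContinuousOn (fun t => a t * upathAbsInv (a t)) s := by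
  refine ha.mul ?_
  unfold upathAbsInv
  refine ContinuousOn.cfc_of_mem_nhdsSet (s := Set.Ioi 0) (fun x : ℝ => (√x)⁻¹) ?_ (ha.star.mul ha)
    (fun t _ => IsSelfAdjoint.star_mul_self _) ?_
  · rw [isOpen_Ioi.mem_nhdsSet]
    intro x hx
    simp only [Set.mem_iUnion] at hx
    obtain ⟨t, ht, hx⟩ := hx
    exact upath_spec (hu t ht) hx
  · refine ContinuousOn.inv₀ (by fun_prop) fun x hx => (Real.sqrt_pos.mpr hx).ne'

lemma upath_absInv_one : upathAbsInv (1 : A) = 1 := by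
  unfold upathAbsInv
  simp

lemma upath_absInv_comm {a p : A} (h : Commute (star a * a) p) : Commute (upathAbsInv a) p := by
  exact h.cfc_real _

lemma upath_final (p q a : A) (hp : IsSelfAdjoint p) (hq : IsSelfAdjoint q)
    (ha : a ∈ upathGL0 A) (hpq : a * p = q * a) :
    ∃ u : ℝ → A, ContinuousOn u (Set.Icc 0 1) ∧
      (∀ t ∈ Set.Icc (0 : ℝ) 1, u t ∈ unitary A) ∧
      u 0 = 1 ∧ u 1 * p * star (u 1) = q := by
  obtain ⟨γ, hγ⟩ := ha
  have hun : ∀ t, IsUnit (γ.extend t) := fun t => hγ _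
  refine ⟨fun t => γ.extend t * upathAbsInv (γ.extend t),
    upath_polar_cont γ.continuous_extend.continuousOn (fun t _ => hun t),
    fun t _ => upath_polar_unitary (hun t), by simp [upath_absInv_one], ?_⟩
  simp only [Path.extend_one]
  have hau : IsUnit a := by simpa using hun 1
  have h1 : p * star a = star a * q := by
    have := congrArg star hpq
    simpa [hp.star_eq, hq.star_eq] using this
  have hc : Commute (star a * a) p := by
    change star a * a * p = p * (star a * a)
    rw [mul_assoc, hpq, ← mul_assoc, ← mul_assoc, h1]
  have hc2 := upath_absInv_comm hc
  have h2 : a * upathAbsInv a * p = q * (a * upathAbsInv a) := by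
    rw [mul_assoc, hc2.eq, ← mul_assoc, hpq, mul_assoc]
  rw [h2, mul_assoc, (upath_polar_unitary hau).2, mul_one]
end Polar

section Main
variable {A : Type*} [CStarAlgebra A]

lemma upath_pi {v p q : A} (hp : p * p = p) (hps : star p = p) (h1 : star v * v = p)
    (h2 : v * star v = q) : v * p = v ∧ q * v = v := by
  have h : v - v * p = 0 := by
    rw [← CStarRing.star_mul_self_eq_zero_iff]
    have : star (v - v * p) * (v - v * p) = star v * v - star v * v * p - p * (star v * v)
        + p * (star v * v) * p := by
      rw [star_sub, star_mul, hps]; noncomm_ring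
    rw [this, h1]; simp [hp]
  have h' : v * p = v := (sub_eq_zero.mp h).symm
  refine ⟨h', ?_⟩
  rw [← h2, mul_assoc, h1, h']

lemma upath_unitary {p q : A} (hp : IsProjection p) (hq : IsProjection q)
    (hpq : MvNEquiv p q) (hpq' : MvNEquiv (1 - p) (1 - q)) :
    ∃ w : Aˣ, (w : A) * p = q * w := by
  obtain ⟨v, hv1, hv2⟩ := hpq
  obtain ⟨x, hx1, hx2⟩ := hpq'
  have hps : star p = p := hp.1
  have hqs : star q = q := hq.1
  obtain ⟨a1, a2⟩ := upath_pi hp.2 hps hv1 hv2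
  have hp1 : (1 - p) * (1 - p) = 1 - p := by simp [mul_sub, sub_mul, hp.2]
  obtain ⟨b1, b2⟩ := upath_pi hp1 (by simp [hps]) hx1 hx2
  have c1 : x * p = 0 := by
    have : x - x * p = x := by rw [← mul_one_sub]; exact b1
    simpa using this
  have c2 : q * x = 0 := by
    have : x - q * x = x := by rw [← one_sub_mul]; exact b2
    simpa using this
  have d1 : star v * x = 0 := by
    rw [← a2, star_mul, hqs, mul_assoc, c2, mul_zero]
  have d2 : star x * v = 0 := by
    have := congrArg star d1
    simpa using this
  have d3 : x * star v = 0 := by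
    rw [← a1, star_mul, hps, ← mul_assoc, c1, zero_mul]
  have d4 : v * star x = 0 := by
    have := congrArg star d3
    simpa using this
  refine ⟨⟨v + x, star v + star x, ?_, ?_⟩, ?_⟩
  · rw [mul_add, add_mul, add_mul, hv2, hx2, d3, d4]; abel
  · rw [mul_add, add_mul, add_mul, hv1, hx1, d1, d2]; abel
  · change (v + x) * p = q * (v + x)
    rw [add_mul, mul_add, a1, a2, c1, c2]

open scoped Matrix.Norms.L2Operator in
/-- The homomorphism into the sequence algebra. -/
noncomputable def upathPsi (N : ℕ)
    (φ : ℕ → (Matrix (Fin N) (Fin N) ℂ × Matrix (Fin (N + 1)) (Fin (N + 1)) ℂ) →⋆ₐ[ℂ] A) :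
    (Matrix (Fin N) (Fin N) ℂ × Matrix (Fin (N + 1)) (Fin (N + 1)) ℂ) →+*
      BoundedContinuousFunction ℕ A where
  toFun d := BoundedContinuousFunction.ofNormedAddCommGroupDiscrete (fun n => φ n d) ‖d‖
    (fun n => NonUnitalStarAlgHom.norm_apply_le (φ n) d)
  map_one' := by ext n; simp
  map_zero' := by ext n; simp
  map_add' x y := by ext n; simp
  map_mul' x y := by ext n; simp

lemma upath_exists (hsimple : IsSimpleCStarAlgebra A) (hdiv : ApproximatelyDivisible A)
    (p : A) (hp : p * p = p) (hp0 : p ≠ 0) (w : Aˣ) :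
    ∃ y : A, Commute y p ∧ (w : A) * y ∈ upathGL0 A := by
  obtain ⟨K, a, b, hab⟩ := upath_full hsimple p hp0
  obtain ⟨φ, hφ⟩ := hdiv (K + 1) (Nat.succ_pos K)
  let ι : A →+* UpathB A := (upathMk A).comp (upathConst A)
  let ψ := (upathMk A).comp (upathPsi (K + 1) φ)
  have hcomm : ∀ d c, Commute (ψ d) (ι c) := by
    intro d c
    change upathMk A _ * upathMk A _ = upathMk A _ * upathMk A _
    rw [← map_mul, ← map_mul, upathMk_eq]
    exact hφ d c
  have hmem := upath_D (upathP A) upathP_nil (ι p) (by rw [← map_mul, hp])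
    (Units.map (ι : A →* UpathB A) w) (fun k => ι (a k)) (fun k => ι (b k))
    (by simp only [← map_mul, ← map_sum, hab, map_one]) ψ (fun d k => hcomm _ _)
    (fun d k => hcomm _ _) (fun d => hcomm _ _) (fun d => hcomm _ _)
  rw [Subgroup.mem_sup_of_normal_left] at hmem
  obtain ⟨e, he, h, hh, heq⟩ := hmem
  obtain ⟨g, hg⟩ := upathMk_surj (↑h⁻¹ : UpathB A)
  have hhp : ι p * (↑h⁻¹ : UpathB A) = ↑h⁻¹ * ι p := by
    rw [Submonoid.mem_units_iff] at hh
    have := hh.2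
    rw [Submonoid.mem_centralizer_iff] at this
    exact this _ rfl
  set P := upathConst A p with hP
  have hιP : upathMk A P = ι p := rfl
  have hev := he (upathConst A w * (P * g * P + (1 - P) * g * (1 - P))) (by
    have e1 : (e : UpathB A) = ι w * ↑h⁻¹ := by
      have : e = Units.map (ι : A →* UpathB A) w * h⁻¹ := by rw [← heq]; group
      rw [this]; simp
    rw [e1, map_mul]
    congr 1
    simp only [map_add, map_mul, map_sub, map_one, hg, hιP]
    have hpp : ι p * ι p = ι p := by rw [← map_mul, hp]
    calc ι p * ↑h⁻¹ * ι p + (1 - ι p) * ↑h⁻¹ * (1 - ι p)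
        = ↑h⁻¹ + (ι p * ↑h⁻¹ * ι p - ι p * ↑h⁻¹)
          + (ι p * ↑h⁻¹ * ι p - ↑h⁻¹ * ι p) := by noncomm_ring
      _ = ↑h⁻¹ := by rw [hhp, mul_assoc, hpp]; simp)
  obtain ⟨n, hn⟩ := hev.exists
  refine ⟨p * g n * p + (1 - p) * g n * (1 - p), ?_, hn⟩
  have h0 : p * (1 - p) = 0 := by rw [mul_sub, hp]; simp
  have h0' : (1 - p) * p = 0 := by rw [sub_mul, hp]; simp
  change _ * p = p * _
  rw [add_mul, mul_add, mul_assoc _ p p, hp, mul_assoc _ (1 - p) p, h0', ← mul_assoc p ((1 - p) * _),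
    ← mul_assoc p (1 - p), h0, ← mul_assoc p (p * _), ← mul_assoc p p, hp]
  simp

lemma upath_main (hsimple : IsSimpleCStarAlgebra A) (hdiv : ApproximatelyDivisible A)
    (p q : A) (hp : IsProjection p) (hq : IsProjection q)
    (hpq : MvNEquiv p q) (hpq' : MvNEquiv (1 - p) (1 - q)) :
    ∃ u : ℝ → A, ContinuousOn u (Set.Icc 0 1) ∧
      (∀ t ∈ Set.Icc (0 : ℝ) 1, u t ∈ unitary A) ∧
      u 0 = 1 ∧ u 1 * p * star (u 1) = q := by
  by_cases hp0 : p = 0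
  · obtain ⟨v, hv1, hv2⟩ := hpq
    rw [hp0, CStarRing.star_mul_self_eq_zero_iff] at hv1
    refine ⟨fun _ => 1, continuousOn_const, fun _ _ => one_mem _, rfl, ?_⟩
    rw [← hv2, hp0, hv1]; simp
  · obtain ⟨w, hw⟩ := upath_unitary hp hq hpq hpq'
    obtain ⟨y, hy, hwy⟩ := upath_exists hsimple hdiv p hp.2 hp0 w
    refine upath_final p q _ hp.1 hq.1 hwy ?_
    rw [mul_assoc, hy.eq, ← mul_assoc, hw, mul_assoc]
end Main

/-- Lemma 4.2 of the paper. In a unital simple approximately divisible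
C*-algebra, projections `p`, `q` with `p ∼ q` and `1 - p ∼ 1 - q` (Murray–von Neumann) are
conjugate by a norm-continuous path of unitaries starting at `1`; in particular they are
homotopic through projections. -/
theorem unitary_path_conjugating_projections {A : Type*} [CStarAlgebra A]
    (hsimple : IsSimpleCStarAlgebra A)
    (hdiv : ApproximatelyDivisible A)
    (p q : A) (hp : IsProjection p) (hq : IsProjection q)
    (hpq : MvNEquiv p q) (hpq' : MvNEquiv (1 - p) (1 - q)) :
    (∃ u : ℝ → A, ContinuousOn u (Set.Icc 0 1) ∧
      (∀ t ∈ Set.Icc (0 : ℝ) 1, u t ∈ unitary A) ∧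
      u 0 = 1 ∧ u 1 * p * star (u 1) = q) ∧
    ∃ ρ : ℝ → A, ContinuousOn ρ (Set.Icc 0 1) ∧ ρ 0 = p ∧ ρ 1 = q ∧
      ∀ t ∈ Set.Icc (0 : ℝ) 1, IsProjection (ρ t) := by
  obtain ⟨u, hu, huu, h0, h1⟩ := upath_main hsimple hdiv p q hp hq hpq hpq'
  refine ⟨⟨u, hu, huu, h0, h1⟩, fun t => u t * p * star (u t),
    (hu.mul continuousOn_const).mul hu.star, by simp [h0], h1, fun t ht => ⟨?_, ?_⟩⟩
  · have hps : star p = p := hp.1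
    change star _ = _
    simp [hps, mul_assoc]
  · have := (huu t ht).1
    calc u t * p * star (u t) * (u t * p * star (u t))
        = u t * p * (star (u t) * u t) * p * star (u t) := by noncomm_ring
      _ = u t * (p * p) * star (u t) := by rw [this]; noncomm_ring
      _ = _ := by rw [hp.2]
end

section
/- Let A be a unital simple approximately divisible stably finite C*-algebra. Let (p_i)_{i≥1} and (q_i)_{i≥1} be sequences of projections in A such that p_i p_j = 0 = q_i q_j for all i ≠ j, and p_i is Murray–von Neumann equivalent to q_i for every i. Set s_k = Σ_{i=1}^k 2^{−i} = 1 − 2^{−k}. Then there is a norm-continuous map u : [0,1) → U(A) into the unitary group of A such that u_0 = 1 and, for every l ≥ 1 and every t ∈ [0,1) with t ≥ s_l, u_t (p_1 + … + p_l) u_t* = q_1 + … + q_l. -/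
open Filter Topology

section
set_option linter.unusedSimpArgs false
namespace IUP
variable {A : Type*} [CStarAlgebra A]

lemma invsqrt (h : A) (hsa : IsSelfAdjoint h) (hpos : ∀ x ∈ spectrum ℝ h, 0 < x) :
    ∃ R : A, IsSelfAdjoint R ∧ R * h * R = 1 ∧ R * R * h = 1 ∧ h * (R * R) = 1 ∧
      (∀ m, Commute h m → Commute R m) ∧ (‖h - 1‖ ≤ 1/2 → ‖R - 1‖ ≤ ‖h - 1‖) := by
  have hc : ContinuousOn (fun t : ℝ => (Real.sqrt t)⁻¹) (spectrum ℝ h) := by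
    apply ContinuousOn.inv₀ (by fun_prop)
    intro x hx
    exact (Real.sqrt_pos.2 (hpos x hx)).ne'
  have hcomm : ∀ m, Commute h m → Commute (cfc (fun t : ℝ => (Real.sqrt t)⁻¹) h) m := by
    intro m hm
    exact hm.cfc_real _
  have hself : IsSelfAdjoint (cfc (fun t : ℝ => (Real.sqrt t)⁻¹) h) := cfc_predicate _ _
  have h1 : cfc (fun t : ℝ => (Real.sqrt t)⁻¹) h * cfc (fun t : ℝ => (Real.sqrt t)⁻¹) h * h = 1 := by
    nth_rewrite 3 [← cfc_id ℝ h]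
    rw [← cfc_mul _ _ _ hc hc, ← cfc_mul (fun t : ℝ => (Real.sqrt t)⁻¹ * (Real.sqrt t)⁻¹) id h (hc.mul hc) (by fun_prop), ← cfc_one ℝ h]
    apply cfc_congr
    intro x hx
    have := hpos x hx
    have h2 := Real.sq_sqrt this.le
    have h3 := (Real.sqrt_pos.2 this).ne'
    simp only [id, Pi.one_apply]
    field_simp
    exact h2.symm
  refine ⟨_, hself, ?_, h1, ?_, hcomm, ?_⟩
  · rw [mul_assoc, ((hcomm h (Commute.refl h)).eq).symm, ← mul_assoc, h1]
  · have := hcomm h (Commute.refl h)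
    rw [← (this.mul_left this).eq, h1]
  · intro hle
    nth_rewrite 1 [← cfc_one ℝ h]
    rw [← cfc_sub _ _ _ hc (by fun_prop)]
    apply norm_cfc_le (norm_nonneg _)
    intro x hx
    have hx1 : |x - 1| ≤ ‖h - 1‖ := by
      have h5 : h - 1 = cfc (fun t : ℝ => t - 1) h := by
        rw [cfc_sub _ _ _ (by fun_prop) (by fun_prop), cfc_id' ℝ h, cfc_const_one ℝ h]
      rw [h5]
      exact norm_apply_le_norm_cfc (fun t : ℝ => t - 1) h hx
    refine le_trans ?_ hx1
    have hx2 : 1/2 ≤ x := by have := abs_le.1 (hx1.trans hle); linarith [this.1]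
    set s := Real.sqrt x with hs
    have hs2 : s ^ 2 = x := Real.sq_sqrt (by linarith)
    have hs0 : 0 < s := Real.sqrt_pos.2 (by linarith)
    have hs3 : 0.7 ≤ s := by
      apply Real.le_sqrt_of_sq_le; norm_num; linarith
    simp only [Pi.one_apply, Real.norm_eq_abs]
    rw [← hs2]
    have e1 : s⁻¹ - 1 = - (s^2 - 1) * (s * (s+1))⁻¹ := by field_simp; ring
    rw [e1, abs_mul, abs_neg, abs_of_pos (a := (s * (s+1))⁻¹) (by positivity)]
    apply mul_le_of_le_one_right (abs_nonneg _)
    apply inv_le_one_of_one_le₀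
    nlinarith

lemma spec_pos_of_norm (h : A) (hsa : IsSelfAdjoint h) (hn : ‖h - 1‖ < 1) :
    ∀ x ∈ spectrum ℝ h, 0 < x := by
  intro x hx
  have h5 : h - 1 = cfc (fun t : ℝ => t - 1) h := by
    rw [cfc_sub _ _ _ (by fun_prop) (by fun_prop), cfc_id' ℝ h, cfc_const_one ℝ h]
  have := norm_apply_le_norm_cfc (fun t : ℝ => t - 1) h hx
  rw [← h5] at this
  have := abs_lt.1 (lt_of_le_of_lt this hn)
  linarith [this.1]

lemma perturb_proj (x : A) (hsa : IsSelfAdjoint x) (hn : ‖x * x - x‖ < 1/4) :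
    ∃ p : A, IsProjection p ∧ ‖x - p‖ ≤ 2 * ‖x * x - x‖ ∧ ∀ m, Commute x m → Commute p m := by
  let χ : ℝ → ℝ := fun t => if t ≤ 1/2 then 0 else 1
  have hsp : ∀ t ∈ spectrum ℝ x, |t * t - t| ≤ ‖x * x - x‖ := by
    intro t ht
    have h5 : x * x - x = cfc (fun t : ℝ => t * t - t) x := by
      rw [cfc_sub _ _ _ (by fun_prop) (by fun_prop), cfc_mul _ _ _ (by fun_prop) (by fun_prop),
        cfc_id' ℝ x]
    rw [h5]
    exact norm_apply_le_norm_cfc (fun t : ℝ => t * t - t) x ht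
  have hne : ∀ t ∈ spectrum ℝ x, t ≠ 1/2 := by
    rintro t ht rfl
    have := (hsp _ ht).trans_lt hn
    norm_num [abs_of_neg] at this
  have hc : ContinuousOn χ (spectrum ℝ x) := by
    intro t ht
    apply ContinuousAt.continuousWithinAt
    rcases lt_or_gt_of_ne (hne t ht) with h | h
    · apply (continuousAt_const (y := (0:ℝ))).congr
      filter_upwards [eventually_lt_nhds h] with s hs
      simp only [χ, if_pos hs.le]
    · apply (continuousAt_const (y := (1:ℝ))).congr
      filter_upwards [eventually_gt_nhds h] with s hs
      simp only [χ, if_neg (not_le.2 hs)]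
  refine ⟨cfc χ x, ⟨cfc_predicate _ _, ?_⟩, ?_, fun m hm => hm.cfc_real _⟩
  · rw [← cfc_mul _ _ _ hc hc]
    apply cfc_congr
    intro t _
    simp only [χ]
    split_ifs <;> simp
  · nth_rewrite 1 [← cfc_id' ℝ x]
    rw [← cfc_sub _ _ _ (by fun_prop) hc]
    apply norm_cfc_le (by positivity)
    intro t ht
    refine le_trans ?_ (mul_le_mul_of_nonneg_left (hsp t ht) (by norm_num))
    rw [Real.norm_eq_abs, show t * t - t = t * (t - 1) by ring, abs_mul]
    simp only [χ]
    split_ifs with h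
    · rw [sub_zero]
      have : 1/2 ≤ |t - 1| := by rw [abs_of_neg (by linarith)]; linarith
      nlinarith [abs_nonneg t]
    · have : 1/2 ≤ |t| := by rw [abs_of_pos (by linarith)]; linarith
      nlinarith [abs_nonneg (t-1)]

/-- homotopy via unitaries -/
def Hom (x y : A) : Prop := ∃ w : unitary A, Joined 1 w ∧ (w : A) * x * star (w : A) = y

lemma Hom.refl (x : A) : Hom x x := ⟨1, Joined.refl _, by simp⟩

lemma Hom.trans {x y z : A} (h1 : Hom x y) (h2 : Hom y z) : Hom x z := by
  obtain ⟨w, hw, rfl⟩ := h1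
  obtain ⟨w', hw', rfl⟩ := h2
  refine ⟨w' * w, ?_, ?_⟩
  · have := hw'.mul hw
    rwa [mul_one] at this
  · simp [mul_assoc]

lemma IsProjection.norm_le' {p : A} (hp : IsProjection p) : ‖p‖ ≤ 1 :=
  IsStarProjection.norm_le p ⟨hp.2, hp.1⟩

lemma close_unitary {p q : A} (hp : IsProjection p) (hq : IsProjection q) (hpq : ‖p - q‖ ≤ 1/8) :
    ∃ u : unitary A, (u : A) * p * star (u : A) = q ∧ ‖(u : A) - 1‖ ≤ 4 * ‖p - q‖ := by
  have hps : star p = p := hp.1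
  have hqs : star q = q := hq.1
  have hpp : p * p = p := hp.2
  have hqq : q * q = q := hq.2
  have hpp' : ∀ y, p * (p * y) = p * y := fun y => by rw [← mul_assoc, hpp]
  have hqq' : ∀ y, q * (q * y) = q * y := fun y => by rw [← mul_assoc, hqq]
  set x : A := q * p + (1 - q) * (1 - p) with hx
  have hx1 : x - 1 = (q - p) * (2 * p - 1) := by
    rw [hx]; simp only [two_mul, mul_add, add_mul, mul_sub, sub_mul, mul_one, one_mul, hpp]; abel
  have hd : ‖q - p‖ = ‖p - q‖ := norm_sub_rev _ _
  set δ := ‖p - q‖ with hδ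
  have hδ0 : 0 ≤ δ := norm_nonneg _
  have hxn : ‖x - 1‖ ≤ 3 * δ := by
    rw [hx1]
    rcases subsingleton_or_nontrivial A with hA | hA
    · rw [Subsingleton.elim ((q - p) * (2 * p - 1)) 0, norm_zero]; positivity
    refine (norm_mul_le _ _).trans ?_
    have : ‖2 * p - 1‖ ≤ 3 := by
      refine (norm_sub_le _ _).trans ?_
      rw [two_mul]
      have := norm_add_le p p
      have := IsProjection.norm_le' hp
      have : ‖(1:A)‖ = 1 := norm_one
      linarith
    rw [hd]
    nlinarith
  have hsx : star x = p * q + (1 - p) * (1 - q) := by simp [hx, hps, hqs]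
  have hh : star x * x - 1 = - ((p - q) * (p - q)) := by
    rw [hsx, hx]; simp only [mul_add, add_mul, mul_sub, sub_mul, mul_one, one_mul, hpp, hqq, mul_assoc, hpp', hqq']; abel
  have hhn : ‖star x * x - 1‖ ≤ δ * δ := by
    rw [hh, norm_neg]; exact norm_mul_le _ _
  have hhsa : IsSelfAdjoint (star x * x) := IsSelfAdjoint.star_mul_self x
  have hhn2 : ‖star x * x - 1‖ ≤ 1/2 := hhn.trans (by nlinarith)
  obtain ⟨R, hR, hR1, hR2, hR3, hR4, hR5⟩ := invsqrt (star x * x) hhsa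
    (spec_pos_of_norm _ hhsa (by linarith))
  have hR5 := hR5 hhn2
  have hRs : star R = R := hR
  have hcp : Commute (star x * x) p := by
    have : star x * x = 1 - (p - q) * (p - q) := by rw [sub_eq_iff_eq_add.1 hh]; abel
    rw [this]
    change _ * _ = _ * _
    simp only [mul_sub, sub_mul, mul_one, one_mul, hpp, hqq, mul_assoc, hpp', hqq']; abel
  have hRp : R * p = p * R := hR4 p hcp
  have hxu : IsUnit x := by
    by_contra hcon
    have h7 : ‖1 - x‖ < 1 := by rw [norm_sub_rev]; linarith
    exact hcon (by simpa using isUnit_one_sub_of_norm_lt_one h7)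
  have hu1 : star (x * R) * (x * R) = 1 := by
    rw [star_mul, hRs, ← hR1]; simp only [mul_assoc]
  have hRu : x * (R * R) * star x = 1 := by
    obtain ⟨X, hX⟩ := hxu
    have h8 : (R * R * star x) * x = 1 := by rw [mul_assoc, hR2]
    have h9 : R * R * star x = ↑X⁻¹ := by
      rw [← hX] at h8
      rw [← hX]; exact Units.eq_inv_of_mul_eq_one_right (by simpa using h8)
    rw [mul_assoc, h9, ← hX, Units.mul_inv]
  have hu2 : (x * R) * star (x * R) = 1 := by
    rw [star_mul, hRs, ← hRu]; simp only [mul_assoc]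
  refine ⟨⟨x * R, Unitary.mem_iff.2 ⟨hu1, hu2⟩⟩, ?_, ?_⟩
  · have hxp : x * p = q * x := by
      rw [hx]; simp only [mul_add, add_mul, mul_sub, sub_mul, mul_one, one_mul, hpp, hqq, mul_assoc, hpp', hqq']; abel
    change x * R * p * star (x * R) = q
    rw [star_mul, hRs, mul_assoc x, hRp, ← mul_assoc x, hxp]
    calc q * x * R * (R * star x) = q * (x * (R * R) * star x) := by simp only [mul_assoc]
      _ = q := by rw [hRu, mul_one]
  · change ‖x * R - 1‖ ≤ _
    have : x * R - 1 = (x - 1) * (R - 1) + (x - 1) + (R - 1) := by noncomm_ring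
    rw [this]
    have h1 := norm_add₃_le (a := (x - 1) * (R - 1)) (b := x - 1) (c := R - 1)
    have h2 := norm_mul_le (x - 1) (R - 1)
    have h3 : ‖R - 1‖ ≤ δ * δ := hR5.trans hhn
    have h4 : ‖x - 1‖ * ‖R - 1‖ ≤ (3 * δ) * (δ * δ) := by gcongr
    have h5 : δ * δ ≤ 1/8 * δ := by gcongr
    have h6 : δ * (δ * δ) ≤ 1/8 * (1/8 * δ) := by gcongr
    linarith

lemma close_Hom {p q : A} (hp : IsProjection p) (hq : IsProjection q) (hpq : ‖p - q‖ ≤ 1/8) :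
    Hom p q := by
  obtain ⟨u, hu, hn⟩ := close_unitary hp hq hpq
  refine ⟨u, Unitary.joined 1 u ?_, hu⟩
  simp only [OneMemClass.coe_one]
  linarith

end IUP

end

section
set_option linter.unusedSimpArgs false
namespace IUP
variable {A : Type*} [CStarAlgebra A]

lemma rot_unitary (P K : A) (hPs : star P = P) (hKs : star K = -K) (hPP : P * P = P)
    (hPK : P * K = K) (hKP : K * P = K) (hKK : K * K = -P) (c s : ℝ) (hcs : c ^ 2 + s ^ 2 = 1) :
    1 + (c - 1) • P + s • K ∈ unitary A := by
  have h1 : star (1 + (c - 1) • P + s • K) = 1 + (c - 1) • P - s • K := by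
    simp [hPs, hKs, sub_eq_add_neg]
  have h2 : (c - 1) + (c - 1) + (c - 1) * (c - 1) + s * s = 0 := by linear_combination hcs
  rw [Unitary.mem_iff, h1]
  constructor
  · simp only [mul_add, add_mul, sub_mul, smul_mul_assoc, mul_smul_comm, one_mul, mul_one, hPP,
      hPK, hKP, hKK]
    trans 1 + ((c - 1) + (c - 1) + (c - 1) * (c - 1) + s * s) • P
    · module
    · rw [h2]; simp
  · simp only [mul_add, add_mul, mul_sub, smul_mul_assoc, mul_smul_comm, one_mul, mul_one, hPP,
      hPK, hKP, hKK]
    trans 1 + ((c - 1) + (c - 1) + (c - 1) * (c - 1) + s * s) • P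
    · module
    · rw [h2]; simp

lemma rotate (D T : A) (hD : star D = D) (hT : T * (star T * T) = T) (hDT : D * T = 0)
    (hDT' : D * star T = 0) (hTT : T * T = 0) : Hom (D + star T * T) (D + T * star T) := by
  have hTD : T * D = 0 := by have := congrArg star hDT'; simpa [hD] using this
  have hTD' : star T * D = 0 := by have := congrArg star hDT; simpa [hD] using this
  have hTT' : star T * star T = 0 := by have := congrArg star hTT; simpa using this
  have hT' : star T * (T * star T) = star T := by
    have := congrArg star hT; simpa [mul_assoc] using this
  have z : ∀ {a b : A}, a * b = 0 → ∀ y, a * (b * y) = 0 := fun h y => by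
    rw [← mul_assoc, h, zero_mul]
  have hT2 : ∀ y, T * (star T * (T * y)) = T * y := fun y => by
    rw [← mul_assoc (star T), ← mul_assoc, hT]
  have hT2' : ∀ y, star T * (T * (star T * y)) = star T * y := fun y => by
    rw [← mul_assoc T, ← mul_assoc, hT']
  set P : A := star T * T + T * star T with hP
  set K : A := T - star T with hK
  have hPs : star P = P := by simp [hP]
  have hKs : star K = -K := by simp [hK]
  have hPP : P * P = P := by
    simp [hP, mul_add, add_mul, mul_assoc, z hTT, z hTT', hT2, hT2']
  have hPK : P * K = K := by
    simp [hP, hK, mul_sub, add_mul, mul_assoc, hTT, hTT', hT, hT']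
  have hKP : K * P = K := by
    simp [hP, hK, mul_add, sub_mul, mul_assoc, z hTT, z hTT', hT, hT']; abel
  have hKK : K * K = - P := by
    simp only [hP, hK, mul_sub, sub_mul, hTT, hTT']; abel
  have hU := rot_unitary P K hPs hKs hPP hPK hKP hKK
  let f : ℝ → unitary A := fun t => ⟨1 + (Real.cos t - 1) • P + Real.sin t • K,
    hU _ _ (Real.cos_sq_add_sin_sq t)⟩
  have hf : Continuous f := by
    apply Continuous.subtype_mk
    fun_prop
  refine ⟨f (Real.pi / 2), ⟨⟨⟨fun t => f (t * (Real.pi / 2)), by fun_prop⟩, ?_, ?_⟩⟩, ?_⟩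
  · apply Subtype.ext; simp [f]
  · apply Subtype.ext; simp [f]
  · have hf1 : (f (Real.pi / 2) : A) = 1 - P + K := by
      simp [f]; abel
    rw [hf1]
    simp only [hP, hK, star_add, star_sub, star_mul, star_star, star_one, mul_add, add_mul, mul_sub,
      sub_mul, one_mul, mul_one, mul_assoc, z hTT, z hTT', hT2, hT2', hTT, hTT', hT, hT', hDT, hDT',
      hTD, hTD', z hDT, z hDT', z hTD, z hTD', mul_zero, zero_mul]
    abel

/-- one block of matrix units -/
structure IsMU {n : ℕ} (e : Fin n → Fin n → A) : Prop where
  star_e : ∀ i j, star (e i j) = e j i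
  mul_e : ∀ i j k l, e i j * e k l = if j = k then e i l else 0

lemma step_move {n : ℕ} {e : Fin n → Fin n → A} (he : IsMU e) {k : ℕ} (a c v D : A)
    (W : Fin k → A) (t : Fin k → Fin n) (ht : Function.Injective t) (s : Fin n)
    (hts : ∀ i, t i ≠ s) (hv : star v * v = a) (hvc : v * star v = c) (hva : v * a = v)
    (hW : ∑ i, star (W i) * W i = a) (hWa : ∀ i, W i * a = W i)
    (hcv : ∀ i j, Commute v (e i j)) (hcW : ∀ m i j, Commute (W m) (e i j))
    (hD : star D = D) (hDs : D * e s s = 0) (hDW : ∀ i, D * (e (t i) (t i) * W i) = 0) :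
    Hom (D + a * e s s) (D + c * e s s) := by
  have hs : star (e s s) = e s s := he.star_e _ _
  have hcv' : ∀ i j, Commute (star v) (e i j) := fun i j => by
    have := (hcv j i).star_star; rwa [he.star_e] at this
  have hcW' : ∀ m i j, Commute (star (W m)) (e i j) := fun m i j => by
    have := (hcW m j i).star_star; rwa [he.star_e] at this
  have hca : ∀ i j, Commute a (e i j) := fun i j => by
    rw [← hv]; exact (hcv' i j).mul_left (hcv i j)
  set T : A := ∑ i, W i * e (t i) s with hT
  have hTs : star T = ∑ i, star (W i) * e s (t i) := by
    rw [hT, star_sum]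
    refine Finset.sum_congr rfl fun i _ => ?_
    rw [star_mul, he.star_e, (hcW' i _ _).eq]
  have hTT : star T * T = a * e s s := by
    rw [hTs, hT, Finset.sum_mul_sum, ← hW, Finset.sum_mul]
    refine Finset.sum_congr rfl fun i _ => ?_
    rw [Finset.sum_eq_single i]
    · rw [mul_assoc, ← mul_assoc (e s (t i)), ← (hcW i _ _).eq, mul_assoc, he.mul_e, if_pos rfl,
        mul_assoc]
    · intro j _ hj
      rw [mul_assoc, ← mul_assoc (e s (t i)), ← (hcW j _ _).eq, mul_assoc, he.mul_e,
        if_neg (fun h => hj (ht h).symm), mul_zero, mul_zero]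
    · simp
  have hTa : T * (a * e s s) = T := by
    rw [hT, Finset.sum_mul]
    refine Finset.sum_congr rfl fun i _ => ?_
    rw [mul_assoc, ← mul_assoc (e (t i) s), ← (hca _ _).eq, mul_assoc, he.mul_e, if_pos rfl,
      ← mul_assoc, hWa]
  have hTe : T * e s s = T := by
    rw [hT, Finset.sum_mul]
    refine Finset.sum_congr rfl fun i _ => ?_
    rw [mul_assoc, he.mul_e, if_pos rfl]
  have heT : e s s * T = 0 := by
    rw [hT, Finset.mul_sum]
    refine Finset.sum_eq_zero fun i _ => ?_
    rw [← mul_assoc, ← (hcW i _ _).eq, mul_assoc, he.mul_e, if_neg (hts i).symm, mul_zero]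
  have hDT : D * T = 0 := by
    rw [hT, Finset.mul_sum]
    refine Finset.sum_eq_zero fun i _ => ?_
    have : W i * e (t i) s = e (t i) (t i) * W i * e (t i) s := by
      rw [← (hcW i _ _).eq, mul_assoc, he.mul_e, if_pos rfl]
    rw [this, ← mul_assoc, hDW, zero_mul]
  have heTs : e s s * star T = star T := by
    have := congrArg star hTe; simpa [hs] using this
  have hTse : star T * e s s = 0 := by
    have := congrArg star heT; simpa [hs] using this
  have hDTs : D * star T = 0 := by
    rw [← heTs, ← mul_assoc, hDs, zero_mul]
  have r1 : Hom (D + star T * T) (D + T * star T) := by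
    refine rotate D T hD (by rw [hTT, hTa]) hDT hDTs ?_
    calc T * T = (T * e s s) * T := by rw [hTe]
      _ = 0 := by rw [mul_assoc, heT, mul_zero]
  set Z : A := v * star T with hZ
  have hZs : star Z = T * star v := by simp [hZ]
  have hZ1 : star Z * Z = T * star T := by
    rw [hZs, hZ]
    calc T * star v * (v * star T) = T * ((star v * v) * (e s s * star T)) := by
          rw [heTs]; simp only [mul_assoc]
      _ = T * (a * e s s) * star T := by rw [hv]; simp only [mul_assoc]
      _ = _ := by rw [hTa]
  have hZ2 : Z * star Z = c * e s s := by
    rw [hZs, hZ]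
    calc v * star T * (T * star v) = v * (star T * T) * star v := by simp only [mul_assoc]
      _ = (v * a) * (e s s * star v) := by rw [hTT]; simp only [mul_assoc]
      _ = _ := by rw [hva, ← (hcv' s s).eq, ← mul_assoc, hvc]
  have r2 : Hom (D + star Z * Z) (D + Z * star Z) := by
    refine rotate D Z hD ?_ ?_ ?_ ?_
    · rw [hZ1, hZ]
      calc v * star T * (T * star T) = v * ((star T * T) * star T) := by simp only [mul_assoc]
        _ = v * star (T * (star T * T)) := by simp [mul_assoc]
        _ = _ := by rw [hTT, hTa]
    · rw [hZ, ← heTs, ← mul_assoc v, (hcv s s).eq, ← mul_assoc, ← mul_assoc, hDs, zero_mul, zero_mul]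
    · rw [hZs, ← mul_assoc, hDT, zero_mul]
    · rw [hZ]
      calc v * star T * (v * star T) = v * star T * (v * e s s * star T) := by
            rw [mul_assoc v (e s s), heTs]
        _ = v * (star T * e s s) * (v * star T) := by rw [(hcv s s).eq]; simp only [mul_assoc]
        _ = 0 := by rw [hTse]; simp
  rw [hTT] at r1
  rw [hZ1, hZ2] at r2
  exact r1.trans r2

end IUP

end

section
set_option linter.unusedSimpArgs false
namespace IUP
variable {A : Type*} [CStarAlgebra A]

lemma block {n : ℕ} {e : Fin n → Fin n → A} (he : IsMU e) {k k' : ℕ} (hn : k + k' + 1 ≤ n)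
    (a c v ρ : A) (w : Fin k → A) (w' : Fin k' → A)
    (hv : star v * v = a) (hvc : v * star v = c) (hva : v * a = v)
    (hw : ∑ i, star (w i) * w i = a) (hwa : ∀ i, w i * a = w i) (haw : ∀ i, a * w i = 0)
    (hw' : ∑ i, star (w' i) * w' i = c) (hwc : ∀ i, c * w' i = 0)
    (hcv : ∀ i j, Commute v (e i j)) (hcw : ∀ m i j, Commute (w m) (e i j))
    (hcw' : ∀ m i j, Commute (w' m) (e i j)) (hρ : star ρ = ρ) (hρe : ∀ i j, ρ * e i j = 0)
    (S : Finset (Fin n)) :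
    Hom (ρ + ∑ i, a * e i i) (ρ + ∑ i, (if i ∈ S then c else a) * e i i) := by
  have hcv' : ∀ i j, Commute (star v) (e i j) := fun i j => by
    have := (hcv j i).star_star; rwa [he.star_e] at this
  have hca : ∀ i j, Commute a (e i j) := fun i j => by
    rw [← hv]; exact (hcv' i j).mul_left (hcv i j)
  have hcc : ∀ i j, Commute c (e i j) := fun i j => by
    rw [← hvc]; exact (hcv i j).mul_left (hcv' i j)
  have has : star a = a := by rw [← hv]; simp
  have hcs : star c = c := by rw [← hvc]; simp
  induction S using Finset.induction_on with
  | empty => simpa using Hom.refl _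
  | insert s S hs ih =>
    refine ih.trans ?_
    set d : Fin n → A := fun i => if i ∈ S then c else a with hd
    have hds : ∀ i, star (d i) = d i := fun i => by simp only [hd]; split_ifs <;> assumption
    have hdc : ∀ i j l, Commute (d i) (e j l) := fun i j l => by
      simp only [hd]; split_ifs
      · exact hcc j l
      · exact hca j l
    set D : A := ρ + ∑ i ∈ Finset.univ.erase s, d i * e i i with hD
    have e1 : ρ + ∑ i, (if i ∈ S then c else a) * e i i = D + a * e s s := by
      rw [← Finset.sum_erase_add _ _ (Finset.mem_univ s), hD, add_assoc, if_neg hs]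
    have e2 : ρ + ∑ i, (if i ∈ insert s S then c else a) * e i i = D + c * e s s := by
      rw [← Finset.sum_erase_add _ _ (Finset.mem_univ s), hD, add_assoc,
        if_pos (Finset.mem_insert_self _ _)]
      congr 2
      refine Finset.sum_congr rfl fun i hi => ?_
      simp only [Finset.mem_insert, hd, Finset.ne_of_mem_erase hi, false_or]
    rw [e1, e2]
    have hDs : D * e s s = 0 := by
      rw [hD, add_mul, hρe, zero_add, Finset.sum_mul]
      refine Finset.sum_eq_zero fun i hi => ?_
      rw [mul_assoc, he.mul_e, if_neg (Finset.ne_of_mem_erase hi), mul_zero]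
    have hDt : ∀ t, t ≠ s → D * e t t = e t t * d t := by
      intro t ht
      rw [hD, add_mul, hρe, zero_add, Finset.sum_mul, Finset.sum_eq_single t]
      · rw [mul_assoc, he.mul_e, if_pos rfl, (hdc t t t).eq]
      · intro i hi hit
        rw [mul_assoc, he.mul_e, if_neg hit, mul_zero]
      · intro h; exact absurd (Finset.mem_erase.2 ⟨ht, Finset.mem_univ _⟩) h
    have hDstar : star D = D := by
      rw [hD, star_add, hρ, star_sum]
      congr 1
      refine Finset.sum_congr rfl fun i hi => ?_
      rw [star_mul, he.star_e, hds, (hdc i i i).eq]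
    set X := (Finset.univ.erase s).filter (fun i => i ∉ S) with hX
    set Y := (Finset.univ.erase s).filter (fun i => i ∈ S) with hY
    have hcard : Y.card + X.card = n - 1 := by
      rw [hX, hY, Finset.card_filter_add_card_filter_not, Finset.card_erase_of_mem (Finset.mem_univ s)]
      simp
    rcases Nat.lt_or_ge X.card k with hlt | hge
    · have hk : k' ≤ Y.card := by omega
      let t : Fin k' → Fin n := fun i => Y.orderEmbOfFin rfl (Fin.castLE hk i)
      have htm : ∀ i, t i ∈ Y := fun i => Finset.orderEmbOfFin_mem _ _ _
      have htS : ∀ i, t i ∈ S := fun i => (Finset.mem_filter.1 (htm i)).2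
      have hts : ∀ i, t i ≠ s := fun i => Finset.ne_of_mem_erase (Finset.mem_filter.1 (htm i)).1
      have hti : Function.Injective t :=
        (Y.orderEmbOfFin rfl).injective.comp (Fin.castLE_injective hk)
      refine step_move he a c v D (fun i => w' i * v) t hti s hts hv hvc hva ?_ ?_ hcv ?_ hDstar hDs ?_
      · have : ∑ i, star (w' i * v) * (w' i * v) = star v * (∑ i, star (w' i) * w' i) * v := by
          rw [Finset.mul_sum, Finset.sum_mul]
          refine Finset.sum_congr rfl fun i _ => ?_
          rw [star_mul]; simp only [mul_assoc]
        rw [this, hw', ← hvc]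
        calc star v * (v * star v) * v = star v * (v * (star v * v)) := by simp only [mul_assoc]
          _ = a := by rw [hv, hva, hv]
      · intro i; rw [mul_assoc, hva]
      · intro m i j; exact (hcw' m i j).mul_left (hcv i j)
      · intro i
        rw [← mul_assoc, hDt _ (hts i)]
        simp only [hd, if_pos (htS i)]
        rw [mul_assoc, ← mul_assoc c, hwc, zero_mul, mul_zero]
    · let t : Fin k → Fin n := fun i => X.orderEmbOfFin rfl (Fin.castLE hge i)
      have htm : ∀ i, t i ∈ X := fun i => Finset.orderEmbOfFin_mem _ _ _
      have htS : ∀ i, t i ∉ S := fun i => (Finset.mem_filter.1 (htm i)).2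
      have hts : ∀ i, t i ≠ s := fun i => Finset.ne_of_mem_erase (Finset.mem_filter.1 (htm i)).1
      have hti : Function.Injective t :=
        (X.orderEmbOfFin rfl).injective.comp (Fin.castLE_injective hge)
      refine step_move he a c v D w t hti s hts hv hvc hva hw hwa hcv hcw hDstar hDs ?_
      intro i
      rw [← mul_assoc, hDt _ (hts i)]
      simp only [hd, if_neg (htS i)]
      rw [mul_assoc, haw, mul_zero]

/-- two blocks of matrix units adding up to one -/
structure DMU (A : Type*) [CStarAlgebra A] (N : ℕ) where
  e : Fin (N + 1) → Fin (N + 1) → A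
  f : Fin (N + 2) → Fin (N + 2) → A
  he : IsMU e
  hf : IsMU f
  hef : ∀ i j k l, e i j * f k l = 0
  hsum : ∑ i, e i i + ∑ j, f j j = 1

lemma DMU.hfe {N : ℕ} (d : DMU A N) (i j k l) : d.f i j * d.e k l = 0 := by
  have := congrArg star (d.hef l k j i)
  simpa [d.he.star_e, d.hf.star_e] using this

lemma IsMU.norm_le {n : ℕ} {e : Fin n → Fin n → A} (he : IsMU e) (i j) : ‖e i j‖ ≤ 1 := by
  have h1 : ‖e j j‖ ≤ 1 := by
    apply IsProjection.norm_le'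
    exact ⟨he.star_e _ _, by rw [he.mul_e, if_pos rfl]⟩
  have h2 : star (e i j) * e i j = e j j := by rw [he.star_e, he.mul_e, if_pos rfl]
  have h3 := CStarRing.norm_star_mul_self (x := e i j)
  rw [h2] at h3
  nlinarith [norm_nonneg (e i j)]

/-- average onto the commutant -/
def DMU.avg {N : ℕ} (d : DMU A N) (x : A) : A :=
  ∑ i, d.e i 0 * x * d.e 0 i + ∑ j, d.f j 0 * x * d.f 0 j

lemma DMU.star_avg {N : ℕ} (d : DMU A N) (x : A) : star (d.avg x) = d.avg (star x) := by
  simp [DMU.avg, d.he.star_e, d.hf.star_e, mul_assoc]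

lemma DMU.avg_comm_e {N : ℕ} (d : DMU A N) (x : A) (k l) : Commute (d.avg x) (d.e k l) := by
  have h1 : d.avg x * d.e k l = d.e k 0 * x * d.e 0 l := by
    rw [DMU.avg, add_mul, Finset.sum_mul, Finset.sum_mul, Finset.sum_eq_single k,
      Finset.sum_eq_zero, add_zero]
    · rw [mul_assoc, d.he.mul_e, if_pos rfl]
    · intro j _; rw [mul_assoc, d.hfe, mul_zero]
    · intro i _ hi; rw [mul_assoc, d.he.mul_e, if_neg hi, mul_zero]
    · simp
  have h2 : d.e k l * d.avg x = d.e k 0 * x * d.e 0 l := by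
    rw [DMU.avg, mul_add, Finset.mul_sum, Finset.mul_sum, Finset.sum_eq_single l,
      Finset.sum_eq_zero, add_zero]
    · rw [← mul_assoc, ← mul_assoc, d.he.mul_e, if_pos rfl]
    · intro j _; rw [← mul_assoc, ← mul_assoc, d.hef, zero_mul, zero_mul]
    · intro i _ hi; rw [← mul_assoc, ← mul_assoc, d.he.mul_e, if_neg hi.symm, zero_mul, zero_mul]
    · simp
  exact h1.trans h2.symm

lemma DMU.avg_comm_f {N : ℕ} (d : DMU A N) (x : A) (k l) : Commute (d.avg x) (d.f k l) := by
  have h1 : d.avg x * d.f k l = d.f k 0 * x * d.f 0 l := by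
    rw [DMU.avg, add_comm, add_mul, Finset.sum_mul, Finset.sum_mul, Finset.sum_eq_single k,
      Finset.sum_eq_zero, add_zero]
    · rw [mul_assoc, d.hf.mul_e, if_pos rfl]
    · intro j _; rw [mul_assoc, d.hef, mul_zero]
    · intro i _ hi; rw [mul_assoc, d.hf.mul_e, if_neg hi, mul_zero]
    · simp
  have h2 : d.f k l * d.avg x = d.f k 0 * x * d.f 0 l := by
    rw [DMU.avg, add_comm, mul_add, Finset.mul_sum, Finset.mul_sum, Finset.sum_eq_single l,
      Finset.sum_eq_zero, add_zero]
    · rw [← mul_assoc, ← mul_assoc, d.hf.mul_e, if_pos rfl]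
    · intro j _; rw [← mul_assoc, ← mul_assoc, d.hfe, zero_mul, zero_mul]
    · intro i _ hi; rw [← mul_assoc, ← mul_assoc, d.hf.mul_e, if_neg hi.symm, zero_mul, zero_mul]
    · simp
  exact h1.trans h2.symm

/-- approximate divisibility in terms of matrix units -/
def AD (A : Type*) [CStarAlgebra A] : Prop := ∀ N : ℕ, ∃ d : ℕ → DMU A N,
  (∀ i j c, Tendsto (fun n => (d n).e i j * c - c * (d n).e i j) atTop (𝓝 0)) ∧
  (∀ i j c, Tendsto (fun n => (d n).f i j * c - c * (d n).f i j) atTop (𝓝 0))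

lemma avg_tendsto {N : ℕ} (d : ℕ → DMU A N) (c : A)
    (h1 : ∀ i j, Tendsto (fun n => (d n).e i j * c - c * (d n).e i j) atTop (𝓝 0))
    (h2 : ∀ i j, Tendsto (fun n => (d n).f i j * c - c * (d n).f i j) atTop (𝓝 0)) :
    Tendsto (fun n => (d n).avg c) atTop (𝓝 c) := by
  have key : ∀ n, (d n).avg c = c - (∑ i, (d n).e i 0 * ((d n).e 0 i * c - c * (d n).e 0 i) +
      ∑ j, (d n).f j 0 * ((d n).f 0 j * c - c * (d n).f 0 j)) := by
    intro n
    have h3 : ∑ i, (d n).e i i * c + ∑ j, (d n).f j j * c = c := by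
      rw [← Finset.sum_mul, ← Finset.sum_mul, ← add_mul, (d n).hsum, one_mul]
    have h4 : ∑ i, (d n).e i 0 * ((d n).e 0 i * c - c * (d n).e 0 i) =
        ∑ i, (d n).e i i * c - ∑ i, (d n).e i 0 * c * (d n).e 0 i := by
      rw [← Finset.sum_sub_distrib]
      refine Finset.sum_congr rfl fun i _ => ?_
      rw [mul_sub, ← mul_assoc, (d n).he.mul_e, if_pos rfl, mul_assoc]
    have h5 : ∑ i, (d n).f i 0 * ((d n).f 0 i * c - c * (d n).f 0 i) =
        ∑ i, (d n).f i i * c - ∑ i, (d n).f i 0 * c * (d n).f 0 i := by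
      rw [← Finset.sum_sub_distrib]
      refine Finset.sum_congr rfl fun i _ => ?_
      rw [mul_sub, ← mul_assoc, (d n).hf.mul_e, if_pos rfl, mul_assoc]
    rw [h4, h5, DMU.avg]
    nth_rewrite 3 [← h3]
    abel
  simp only [key]
  have hz : ∀ (a b : ℕ → A), (∀ n, ‖a n‖ ≤ 1) → Tendsto b atTop (𝓝 0) →
      Tendsto (fun n => a n * b n) atTop (𝓝 0) := by
    intro a b ha hb
    refine squeeze_zero_norm (fun n => ?_) (tendsto_zero_iff_norm_tendsto_zero.1 hb)
    refine (norm_mul_le _ _).trans ?_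
    exact mul_le_of_le_one_left (norm_nonneg _) (ha n)
  have := (tendsto_finsetSum (f := fun i n => (d n).e i 0 * ((d n).e 0 i * c - c * (d n).e 0 i))
    Finset.univ (fun i _ => hz _ _ (fun n => (d n).he.norm_le i 0) (h1 0 i))).add
    (tendsto_finsetSum (f := fun i n => (d n).f i 0 * ((d n).f 0 i * c - c * (d n).f 0 i))
    Finset.univ (fun i _ => hz _ _ (fun n => (d n).hf.norm_le i 0) (h2 0 i)))
  simpa using (tendsto_const_nhds (x := c)).sub this

lemma perturb_seq (x : ℕ → A) (hx : ∀ n, IsSelfAdjoint (x n)) (p : A) (hp : IsProjection p)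
    (hxp : Tendsto x atTop (𝓝 p)) : ∃ P : ℕ → A, Tendsto P atTop (𝓝 p) ∧
      ∀ᶠ n in atTop, IsProjection (P n) ∧ ∀ m, Commute (x n) m → Commute (P n) m := by
  have h1 : ∀ n, ∃ P, ‖x n * x n - x n‖ < 1/4 →
      (IsProjection P ∧ ‖x n - P‖ ≤ 2 * ‖x n * x n - x n‖ ∧ ∀ m, Commute (x n) m → Commute P m) := by
    intro n
    by_cases h : ‖x n * x n - x n‖ < 1/4
    · obtain ⟨P, hP⟩ := perturb_proj (x n) (hx n) h
      exact ⟨P, fun _ => hP⟩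
    · exact ⟨0, fun h' => absurd h' h⟩
  choose P hP using h1
  have h2 : Tendsto (fun n => ‖x n * x n - x n‖) atTop (𝓝 0) := by
    have := ((hxp.mul hxp).sub hxp).norm
    rwa [hp.2, sub_self, norm_zero] at this
  have h3 : ∀ᶠ n in atTop, ‖x n * x n - x n‖ < 1/4 := h2.eventually_lt_const (by norm_num)
  refine ⟨P, ?_, h3.mono fun n hn => ⟨(hP n hn).1, (hP n hn).2.2⟩⟩
  have h4 : Tendsto (fun n => x n - P n) atTop (𝓝 0) := by
    refine squeeze_zero_norm' (h3.mono fun n hn => (hP n hn).2.1) ?_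
    simpa using h2.const_mul 2
  simpa using hxp.sub h4

lemma polar_sub {k : ℕ} (P : A) (hP : IsProjection P) (W : Fin k → A) (hWP : ∀ i, W i * P = W i)
    (hn : ‖∑ i, star (W i) * W i - P‖ < 1) :
    ∃ R : A, star R = R ∧ Commute R P ∧ ∑ i, star (W i * R) * (W i * R) = P ∧
      R * R * (∑ i, star (W i) * W i) = P ∧
      ∀ m, Commute (∑ i, star (W i) * W i) m → Commute P m → Commute R m := by
  set g := ∑ i, star (W i) * W i with hg
  have hgP : g * P = g := by
    rw [hg, Finset.sum_mul]; exact Finset.sum_congr rfl fun i _ => by rw [mul_assoc, hWP]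
  have hgs : star g = g := by simp [hg]
  have hPs : star P = P := hP.1
  have hPg : P * g = g := by have := congrArg star hgP; simpa [hgs, hPs] using this
  set h := g + (1 - P) with hh
  have hhP : h * P = g := by rw [hh, add_mul, hgP, sub_mul, one_mul, hP.2]; simp
  have hPh : P * h = g := by rw [hh, mul_add, hPg, mul_sub, mul_one, hP.2]; simp
  have hsa : IsSelfAdjoint h := by
    change star h = h
    simp [hh, hgs, hPs]
  obtain ⟨R, hR, hR1, hR2, hR3, hR4, -⟩ := invsqrt h hsa (spec_pos_of_norm h hsa (by
    have : h - 1 = g - P := by rw [hh]; abel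
    rwa [this]))
  have hRP : Commute R P := hR4 P (hhP.trans hPh.symm)
  have hRs : star R = R := hR
  refine ⟨R, hR, hRP, ?_, ?_, ?_⟩
  · have : ∑ i, star (W i * R) * (W i * R) = R * g * R := by
      rw [hg, Finset.mul_sum, Finset.sum_mul]
      refine Finset.sum_congr rfl fun i _ => ?_
      rw [star_mul, hRs]; simp only [mul_assoc]
    rw [this, ← hhP, ← mul_assoc, mul_assoc _ P, ← hRP.eq, ← mul_assoc, hR1, one_mul]
  · rw [← hhP, ← mul_assoc, hR2, one_mul]
  · intro m hm1 hm2
    refine hR4 m ?_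
    exact hm1.add_left ((Commute.one_left m).sub_left hm2)

lemma polar_eq (P Q V : A) (hP : IsProjection P) (hQ : IsProjection Q) (hVP : V * P = V)
    (hQV : Q * V = V) (hn : ‖star V * V - P‖ < 1) (hn' : ‖V * star V - Q‖ < 1) :
    ∃ v : A, star v * v = P ∧ v * star v = Q ∧
      ∀ m, Commute V m → Commute (star V) m → Commute P m → Commute v m := by
  obtain ⟨R, hR, hRP, h1, h2, h3⟩ := polar_sub (k := 1) P hP (fun _ => V) (fun _ => hVP)
    (by simpa using hn)
  simp only [Finset.univ_unique, Finset.sum_const, Finset.card_singleton, one_smul] at h1 h2 h3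
  have hQs : star Q = Q := hQ.1
  have hVQ : star V * Q = star V := by have := congrArg star hQV; simpa [hQs] using this
  refine ⟨V * R, h1, ?_, fun m hm1 hm2 hm3 => hm1.mul_left (h3 m (hm2.mul_left hm1) hm3)⟩
  set E := V * R * star (V * R) with hE
  have hE' : E = V * (R * R) * star V := by rw [hE, star_mul, hR]; simp only [mul_assoc]
  have hEV : E * V = V := by
    rw [hE', mul_assoc, mul_assoc, h2, hVP]
  have hEQ : E * Q = E := by rw [hE', mul_assoc, hVQ]
  have hu : IsUnit (V * star V + (1 - Q)) := by
    have h7 : ‖Q - V * star V‖ < 1 := by rwa [norm_sub_rev]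
    have := isUnit_one_sub_of_norm_lt_one h7
    convert this using 1
    abel
  have h0 : (Q - E) * (V * star V + (1 - Q)) = 0 := by
    have e1 : (Q - E) * (V * star V) = 0 := by
      rw [← mul_assoc, sub_mul, hQV, hEV, sub_self, zero_mul]
    rw [mul_add, e1, mul_sub, mul_one, sub_mul, hQ.2, hEQ]; simp
  have := hu.mul_left_eq_zero.1 h0
  exact (sub_eq_zero.1 this).symm
end IUP

end

section
set_option linter.unusedSimpArgs false
namespace IUP
variable {A : Type*} [CStarAlgebra A]

lemma pi_mul {v p : A} (hv : star v * v = p) (hp : IsProjection p) : v * p = v := by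
  have hps : star p = p := hp.1
  have h : star (v * p - v) * (v * p - v) = 0 := by
    simp only [star_sub, star_mul, hps, sub_mul, mul_sub]
    have e1 : p * star v * (v * p) = p := by
      rw [mul_assoc, ← mul_assoc (star v), hv, hp.2, hp.2]
    have e2 : p * star v * v = p := by rw [mul_assoc, hv, hp.2]
    have e3 : star v * (v * p) = p := by rw [← mul_assoc, hv, hp.2]
    rw [e1, e2, e3, hv]; simp
  exact sub_eq_zero.1 (CStarRing.star_mul_self_eq_zero_iff _ |>.1 h)

lemma L_main (hAD : AD A) {p q v : A} (hp : IsProjection p) (hq : IsProjection q)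
    (hv : star v * v = p) (hvq : v * star v = q) {k k' : ℕ} (w : Fin k → A) (w' : Fin k' → A)
    (hw : ∑ i, star (w i) * w i = p) (hwp : ∀ i, w i * p = w i) (hpw : ∀ i, p * w i = 0)
    (hw' : ∑ i, star (w' i) * w' i = q) (hwp' : ∀ i, w' i * q = w' i) (hpw' : ∀ i, q * w' i = 0) :
    Hom p q := by
  obtain ⟨d, hd1, hd2⟩ := hAD (k + k')
  have hE : ∀ c, Tendsto (fun n => (d n).avg c) atTop (𝓝 c) := fun c =>
    avg_tendsto d c (fun i j => hd1 i j c) (fun i j => hd2 i j c)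
  have hsa : ∀ c : A, IsSelfAdjoint c → ∀ n, IsSelfAdjoint ((d n).avg c) := fun c hc n => by
    change star _ = _
    rw [DMU.star_avg, hc.star_eq]
  obtain ⟨P, hPt, hP⟩ := perturb_seq _ (hsa p hp.1) p hp (hE p)
  obtain ⟨Q, hQt, hQ⟩ := perturb_seq _ (hsa q hq.1) q hq (hE q)
  have hvp : v * p = v := pi_mul hv hp
  have hqv : q * v = v := by rw [← hvq, mul_assoc, hv, hvp]
  let V : ℕ → A := fun n => Q n * (d n).avg v * P n
  have hVt : Tendsto V atTop (𝓝 v) := by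
    have := (hQt.mul (hE v)).mul hPt
    rwa [hqv, hvp] at this
  let W : Fin k → ℕ → A := fun i n => (1 - P n) * (d n).avg (w i) * P n
  have hWt : ∀ i, Tendsto (W i) atTop (𝓝 (w i)) := fun i => by
    have := ((tendsto_const_nhds (x := (1:A)).sub hPt).mul (hE (w i))).mul hPt
    rwa [sub_mul, one_mul, hpw, sub_zero, hwp] at this
  let W' : Fin k' → ℕ → A := fun i n => (1 - Q n) * (d n).avg (w' i) * Q n
  have hWt' : ∀ i, Tendsto (W' i) atTop (𝓝 (w' i)) := fun i => by
    have := ((tendsto_const_nhds (x := (1:A)).sub hQt).mul (hE (w' i))).mul hQt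
    rwa [sub_mul, one_mul, hpw', sub_zero, hwp'] at this
  have c1 : ∀ᶠ n in atTop, ‖star (V n) * V n - P n‖ < 1 := by
    have := ((hVt.star.mul hVt).sub hPt).norm
    rw [hv, sub_self, norm_zero] at this
    exact this.eventually_lt_const one_pos
  have c2 : ∀ᶠ n in atTop, ‖V n * star (V n) - Q n‖ < 1 := by
    have := ((hVt.mul hVt.star).sub hQt).norm
    rw [hvq, sub_self, norm_zero] at this
    exact this.eventually_lt_const one_pos
  have c3 : ∀ᶠ n in atTop, ‖∑ i, star (W i n) * W i n - P n‖ < 1 := by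
    have := ((tendsto_finsetSum (f := fun i n => star (W i n) * W i n) Finset.univ
      (fun i _ => (hWt i).star.mul (hWt i))).sub hPt).norm
    rw [hw, sub_self, norm_zero] at this
    exact this.eventually_lt_const one_pos
  have c4 : ∀ᶠ n in atTop, ‖∑ i, star (W' i n) * W' i n - Q n‖ < 1 := by
    have := ((tendsto_finsetSum (f := fun i n => star (W' i n) * W' i n) Finset.univ
      (fun i _ => (hWt' i).star.mul (hWt' i))).sub hQt).norm
    rw [hw', sub_self, norm_zero] at this
    exact this.eventually_lt_const one_pos
  have c5 : ∀ᶠ n in atTop, ‖p - P n‖ < 1/8 := by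
    have := ((tendsto_const_nhds (x := p)).sub hPt).norm
    rw [sub_self, norm_zero] at this
    exact this.eventually_lt_const (by norm_num)
  have c6 : ∀ᶠ n in atTop, ‖Q n - q‖ < 1/8 := by
    have := (hQt.sub (tendsto_const_nhds (x := q))).norm
    rw [sub_self, norm_zero] at this
    exact this.eventually_lt_const (by norm_num)
  obtain ⟨n, ⟨hPn, hPc⟩, ⟨hQn, hQc⟩, c1, c2, c3, c4, c5, c6⟩ :=
    (hP.and (hQ.and (c1.and (c2.and (c3.and (c4.and (c5.and c6))))))).exists
  refine (close_Hom hp hPn c5.le).trans (Hom.trans ?_ (close_Hom hQn hq c6.le))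
  -- commutant
  let B : A → Prop := fun x => (∀ i j, Commute x ((d n).e i j)) ∧ ∀ i j, Commute x ((d n).f i j)
  have hBmul : ∀ x y, B x → B y → B (x * y) := fun x y hx hy =>
    ⟨fun i j => (hx.1 i j).mul_left (hy.1 i j), fun i j => (hx.2 i j).mul_left (hy.2 i j)⟩
  have hBstar : ∀ x, B x → B (star x) := fun x hx =>
    ⟨fun i j => by have := (hx.1 j i).star_star; rwa [(d n).he.star_e] at this,
      fun i j => by have := (hx.2 j i).star_star; rwa [(d n).hf.star_e] at this⟩
  have hBavg : ∀ x, B ((d n).avg x) := fun x => ⟨(d n).avg_comm_e x, (d n).avg_comm_f x⟩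
  have hBP : B (P n) := ⟨fun i j => hPc _ ((hBavg p).1 i j), fun i j => hPc _ ((hBavg p).2 i j)⟩
  have hBQ : B (Q n) := ⟨fun i j => hQc _ ((hBavg q).1 i j), fun i j => hQc _ ((hBavg q).2 i j)⟩
  have hB1 : ∀ x, B x → B (1 - x) := fun x hx =>
    ⟨fun i j => (Commute.one_left _).sub_left (hx.1 i j),
      fun i j => (Commute.one_left _).sub_left (hx.2 i j)⟩
  have hBsum : ∀ {m : ℕ} (x : Fin m → A), (∀ i, B (x i)) → B (∑ i, x i) := fun x hx =>
    ⟨fun i j => Commute.sum_left _ _ _ (fun m _ => (hx m).1 i j),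
      fun i j => Commute.sum_left _ _ _ (fun m _ => (hx m).2 i j)⟩
  have hBV : B (V n) := hBmul _ _ (hBmul _ _ hBQ (hBavg v)) hBP
  have hBW : ∀ i, B (W i n) := fun i => hBmul _ _ (hBmul _ _ (hB1 _ hBP) (hBavg _)) hBP
  have hBW' : ∀ i, B (W' i n) := fun i => hBmul _ _ (hBmul _ _ (hB1 _ hBQ) (hBavg _)) hBQ
  obtain ⟨v1, hv1, hv1', hv1c⟩ := polar_eq (P n) (Q n) (V n) hPn hQn
    (by simp only [V]; rw [mul_assoc, hPn.2]) (by simp only [V]; rw [← mul_assoc, ← mul_assoc, hQn.2])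
    c1 c2
  have hBv1 : B v1 := ⟨fun i j => hv1c _ (hBV.1 i j) ((hBstar _ hBV).1 i j) (hBP.1 i j),
    fun i j => hv1c _ (hBV.2 i j) ((hBstar _ hBV).2 i j) (hBP.2 i j)⟩
  have hWP : ∀ i, W i n * P n = W i n := fun i => by simp only [W]; rw [mul_assoc, hPn.2]
  have hPW : ∀ i, P n * W i n = 0 := fun i => by
    simp only [W]; rw [← mul_assoc, ← mul_assoc, mul_sub, mul_one, hPn.2, sub_self, zero_mul, zero_mul]
  have hWP' : ∀ i, W' i n * Q n = W' i n := fun i => by simp only [W']; rw [mul_assoc, hQn.2]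
  have hPW' : ∀ i, Q n * W' i n = 0 := fun i => by
    simp only [W']; rw [← mul_assoc, ← mul_assoc, mul_sub, mul_one, hQn.2, sub_self, zero_mul, zero_mul]
  obtain ⟨R, hRs, hRP, hR1, -, hRc⟩ := polar_sub (P n) hPn (fun i => W i n) hWP c3
  obtain ⟨R', hRs', hRP', hR1', -, hRc'⟩ := polar_sub (Q n) hQn (fun i => W' i n) hWP' c4
  have hBs := hBsum _ fun i => hBmul _ _ (hBstar _ (hBW i)) (hBW i)
  have hBs' := hBsum _ fun i => hBmul _ _ (hBstar _ (hBW' i)) (hBW' i)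
  have hBR : B R := ⟨fun i j => hRc _ (hBs.1 i j) (hBP.1 i j), fun i j => hRc _ (hBs.2 i j) (hBP.2 i j)⟩
  have hBR' : B R' :=
    ⟨fun i j => hRc' _ (hBs'.1 i j) (hBQ.1 i j), fun i j => hRc' _ (hBs'.2 i j) (hBQ.2 i j)⟩
  have hBWR : ∀ i, B (W i n * R) := fun i => hBmul _ _ (hBW i) hBR
  have hBWR' : ∀ i, B (W' i n * R') := fun i => hBmul _ _ (hBW' i) hBR'
  have a1 : ∀ i, W i n * R * P n = W i n * R := fun i => by
    rw [mul_assoc, hRP.eq, ← mul_assoc, hWP]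
  have a2 : ∀ i, P n * (W i n * R) = 0 := fun i => by rw [← mul_assoc, hPW, zero_mul]
  have a3 : ∀ i, Q n * (W' i n * R') = 0 := fun i => by rw [← mul_assoc, hPW', zero_mul]
  have hPs : star (P n) = P n := hPn.1
  have hQs : star (Q n) = Q n := hQn.1
  have es : star (∑ i, (d n).e i i) = ∑ i, (d n).e i i := by simp [(d n).he.star_e]
  have fs : star (∑ i, (d n).f i i) = ∑ i, (d n).f i i := by simp [(d n).hf.star_e]
  have b1 := block (d n).he (k := k) (k' := k') le_rfl (P n) (Q n) v1 (P n * ∑ j, (d n).f j j) _ _ hv1 hv1'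
    (pi_mul hv1 hPn) hR1 a1 a2 hR1' a3 hBv1.1 (fun m => (hBWR m).1) (fun m => (hBWR' m).1)
    (by rw [star_mul, fs, hPs]; exact (Commute.sum_right _ _ _ (fun i _ => hBP.2 i i)).eq.symm)
    (fun i j => by
      rw [mul_assoc, Finset.sum_mul, Finset.sum_eq_zero, mul_zero]
      intro l _; exact (d n).hfe _ _ _ _) Finset.univ
  have b2 := block (d n).hf (k := k) (k' := k') (by omega) (P n) (Q n) v1 (Q n * ∑ j, (d n).e j j) _ _ hv1 hv1'
    (pi_mul hv1 hPn) hR1 a1 a2 hR1' a3 hBv1.2 (fun m => (hBWR m).2) (fun m => (hBWR' m).2)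
    (by rw [star_mul, es, hQs]; exact (Commute.sum_right _ _ _ (fun i _ => hBQ.1 i i)).eq.symm)
    (fun i j => by
      rw [mul_assoc, Finset.sum_mul, Finset.sum_eq_zero, mul_zero]
      intro l _; exact (d n).hef _ _ _ _) Finset.univ
  simp only [Finset.mem_univ, if_true, ← Finset.mul_sum, ← mul_add] at b1 b2
  rw [add_comm (∑ j, (d n).f j j), (d n).hsum, mul_one] at b1
  rw [(d n).hsum, mul_one] at b2
  have : P n * ∑ j, (d n).f j j + Q n * ∑ i, (d n).e i i =
    Q n * ∑ i, (d n).e i i + P n * ∑ j, (d n).f j j := add_comm _ _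
  rw [this] at b1
  exact b1.trans b2

lemma AD_of (h : ApproximatelyDivisible A) : AD A := by
  intro N
  obtain ⟨φ, hφ⟩ := h (N + 1) (Nat.succ_pos N)
  have key : ∀ x c, Tendsto (fun n => φ n x * c - c * φ n x) atTop (𝓝 0) := fun x c =>
    tendsto_zero_iff_norm_tendsto_zero.2 (hφ x c)
  refine ⟨fun n => ⟨fun i j => φ n (Matrix.single i j 1, 0), fun i j => φ n (0, Matrix.single i j 1),
    ⟨?_, ?_⟩, ⟨?_, ?_⟩, ?_, ?_⟩, fun i j c => key _ c, fun i j c => key _ c⟩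
  · intro i j; rw [← map_star]; congr 1; ext : 1 <;> simp [Matrix.star_eq_conjTranspose]
  · intro i j k l
    rw [← map_mul]
    split_ifs with h
    · subst h; simp
    · simp [h, Matrix.single_mul_single_of_ne, ← Prod.zero_eq_mk]
  · intro i j; rw [← map_star]; congr 1; ext : 1 <;> simp [Matrix.star_eq_conjTranspose]
  · intro i j k l
    rw [← map_mul]
    split_ifs with h
    · subst h; simp
    · simp [h, Matrix.single_mul_single_of_ne, ← Prod.zero_eq_mk]
  · intro i j k l
    rw [← map_mul]; simp [← Prod.zero_eq_mk]
  · rw [← map_sum, ← map_sum, ← map_add, ← map_one (φ n)]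
    congr 1
    ext : 1
    · simp [Prod.fst_sum, Matrix.sum_single_one]
    · simp [Prod.snd_sum, Matrix.sum_single_one]

/-- commutant of a single element -/
abbrev Cr (r : A) : StarSubalgebra ℂ A := StarSubalgebra.centralizer ℂ {r}

instance instClosedCr (r : A) : IsClosed ((Cr r : StarSubalgebra ℂ A) : Set A) := by
  rw [StarSubalgebra.coe_centralizer]
  exact Set.isClosed_centralizer _

lemma mem_Cr {r : A} (hr : star r = r) {x : A} : x ∈ Cr r ↔ r * x = x * r := by
  simp [StarSubalgebra.mem_centralizer_iff, hr]

lemma AD_Cr (hAD : AD A) {r : A} (hr : IsProjection r) : AD (Cr r) := by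
  intro N
  have hrs : star r = r := hr.1
  obtain ⟨d, hd1, hd2⟩ := hAD N
  have hE : Tendsto (fun n => (d n).avg r) atTop (𝓝 r) :=
    avg_tendsto d r (fun i j => hd1 i j r) (fun i j => hd2 i j r)
  obtain ⟨P, hPt, hP⟩ := perturb_seq (fun n => (d n).avg r)
    (fun n => by change star _ = _; rw [DMU.star_avg, hrs]) r hr hE
  have c0 : Tendsto (fun n => ‖r - P n‖) atTop (𝓝 0) := by
    have := ((tendsto_const_nhds (x := r)).sub hPt).norm
    rwa [sub_self, norm_zero] at this
  have c5 : ∀ᶠ n in atTop, ‖r - P n‖ < 1/8 := c0.eventually_lt_const (by norm_num)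
  obtain ⟨n0, hn0⟩ := eventually_atTop.1 (hP.and c5)
  have hu : ∀ n, ∃ u : unitary A, (u : A) * r * star (u : A) = P (n + n0) ∧
      ‖(u : A) - 1‖ ≤ 4 * ‖r - P (n + n0)‖ := fun n =>
    close_unitary hr (hn0 (n + n0) (by omega)).1.1 (hn0 (n + n0) (by omega)).2.le
  choose u hu1 hu2 using hu
  have hut : Tendsto (fun n => ‖(u n : A) - 1‖) atTop (𝓝 0) := by
    refine squeeze_zero (fun _ => norm_nonneg _) hu2 ?_
    simpa using ((tendsto_add_atTop_iff_nat n0).2 c0).const_mul 4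
  have uu : ∀ n, (u n : A) * star (u n : A) = 1 := fun n => Unitary.mul_star_self_of_mem (u n).2
  have uu' : ∀ n, star (u n : A) * (u n : A) = 1 := fun n => Unitary.star_mul_self_of_mem (u n).2
  have hmul : ∀ n (a b : A), star (u n : A) * a * u n * (star (u n : A) * b * u n) =
      star (u n : A) * (a * b) * u n := fun n a b => by
    calc _ = star (u n : A) * a * ((u n : A) * star (u n : A)) * b * u n := by simp only [mul_assoc]
      _ = _ := by rw [uu]; simp only [mul_assoc, mul_one]
  have hmem : ∀ n (a : A), Commute (P (n + n0)) a → star (u n : A) * a * u n ∈ Cr r := by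
    intro n a ha
    rw [mem_Cr hrs]
    have hr' : r = star (u n : A) * P (n + n0) * u n := by
      rw [← hu1]
      calc r = (star (u n : A) * u n) * r * (star (u n : A) * u n) := by rw [uu']; simp
        _ = _ := by simp only [mul_assoc]
    rw [hr', hmul, hmul, ha.eq]
  have he : ∀ n i j, star (u n : A) * (d (n + n0)).e i j * u n ∈ Cr r := fun n i j =>
    hmem n _ ((hn0 (n + n0) (by omega)).1.2 _ ((d _).avg_comm_e r i j))
  have hf : ∀ n i j, star (u n : A) * (d (n + n0)).f i j * u n ∈ Cr r := fun n i j =>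
    hmem n _ ((hn0 (n + n0) (by omega)).1.2 _ ((d _).avg_comm_f r i j))
  have hlim : ∀ (x : ℕ → A) (c : A), (∀ n, ‖x n‖ ≤ 1) →
      Tendsto (fun n => x n * c - c * x n) atTop (𝓝 0) →
      Tendsto (fun n => (star (u n : A) * x n * u n) * c - c * (star (u n : A) * x n * u n)) atTop (𝓝 0) := by
    intro x c hx1 hx2
    have h1 : Tendsto (fun n => star (u n : A) * x n * u n - x n) atTop (𝓝 0) := by
      refine squeeze_zero_norm (a := fun n => ‖(u n : A) - 1‖ + ‖(u n : A) - 1‖) (fun n => ?_)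
        (by simpa using hut.add hut)
      have e1 : star (u n : A) * x n * u n - x n = star (u n : A) * (x n * (u n - 1)) +
        star ((u n : A) - 1) * x n := by
        rw [star_sub, star_one]; noncomm_ring
      rw [e1]
      refine (norm_add_le _ _).trans (add_le_add ?_ ?_)
      · have : ‖star (u n : A) * (x n * (u n - 1))‖ = ‖x n * ((u n : A) - 1)‖ :=
          CStarRing.norm_coe_unitary_mul (star (u n)) _
        rw [this]
        exact (norm_mul_le _ _).trans (mul_le_of_le_one_left (norm_nonneg _) (hx1 n))
      · refine (norm_mul_le _ _).trans ?_
        rw [norm_star]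
        exact mul_le_of_le_one_right (norm_nonneg _) (hx1 n)
    have h2 := (hx2.add (h1.mul_const c)).sub (h1.const_mul c)
    simp only [zero_mul, mul_zero, add_zero, sub_zero] at h2
    refine h2.congr fun n => ?_
    noncomm_ring
  refine ⟨fun n => ⟨fun i j => ⟨_, he n i j⟩, fun i j => ⟨_, hf n i j⟩, ⟨?_, ?_⟩, ⟨?_, ?_⟩, ?_, ?_⟩,
    ?_, ?_⟩
  · intro i j
    apply Subtype.ext
    change star (star (u n : A) * (d (n + n0)).e i j * u n) = _
    simp [mul_assoc, (d (n + n0)).he.star_e]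
  · intro i j k l
    apply Subtype.ext
    change star (u n : A) * (d (n + n0)).e i j * u n * (star (u n : A) * (d (n + n0)).e k l * u n) = _
    rw [hmul, (d (n + n0)).he.mul_e]
    split_ifs <;> simp
  · intro i j
    apply Subtype.ext
    change star (star (u n : A) * (d (n + n0)).f i j * u n) = _
    simp [mul_assoc, (d (n + n0)).hf.star_e]
  · intro i j k l
    apply Subtype.ext
    change star (u n : A) * (d (n + n0)).f i j * u n * (star (u n : A) * (d (n + n0)).f k l * u n) = _
    rw [hmul, (d (n + n0)).hf.mul_e]
    split_ifs <;> simp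
  · intro i j k l
    apply Subtype.ext
    change star (u n : A) * (d (n + n0)).e i j * u n * (star (u n : A) * (d (n + n0)).f k l * u n) = _
    rw [hmul, (d (n + n0)).hef]
    simp
  · apply Subtype.ext
    push_cast
    rw [← Finset.sum_mul, ← Finset.sum_mul, ← Finset.mul_sum, ← Finset.mul_sum, ← add_mul, ← mul_add,
      (d (n + n0)).hsum, mul_one, uu']
  · intro i j c
    rw [tendsto_subtype_rng]
    exact hlim (fun n => (d (n + n0)).e i j) c (fun n => (d _).he.norm_le _ _)
      ((tendsto_add_atTop_iff_nat n0).2 (hd1 i j (c : A)))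
  · intro i j c
    rw [tendsto_subtype_rng]
    exact hlim (fun n => (d (n + n0)).f i j) c (fun n => (d _).hf.norm_le _ _)
      ((tendsto_add_atTop_iff_nat n0).2 (hd2 i j (c : A)))
end IUP

end

section
set_option linter.unusedSimpArgs false
namespace IUP
variable {A : Type*} [CStarAlgebra A]

/-- The closed two-sided ideal generated by `b`. -/
def genSub (b : A) : AddSubgroup A := AddSubgroup.closure {g | ∃ x y : A, g = x * b * y}

lemma genSub_left (b : A) {g : A} (z : A) (hg : g ∈ genSub b) : z * g ∈ genSub b := by
  refine AddSubgroup.closure_induction (p := fun g _ => z * g ∈ genSub b) ?_ ?_ ?_ ?_ hg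
  · rintro _ ⟨x, y, rfl⟩
    exact AddSubgroup.subset_closure ⟨z * x, y, by simp only [mul_assoc]⟩
  · simp [zero_mem]
  · intro a c _ _ h1 h2
    rw [mul_add]; exact add_mem h1 h2
  · intro a _ h1
    rw [mul_neg]; exact neg_mem h1

lemma genSub_right (b : A) {g : A} (z : A) (hg : g ∈ genSub b) : g * z ∈ genSub b := by
  refine AddSubgroup.closure_induction (p := fun g _ => g * z ∈ genSub b) ?_ ?_ ?_ ?_ hg
  · rintro _ ⟨x, y, rfl⟩
    exact AddSubgroup.subset_closure ⟨x, y * z, by simp only [mul_assoc]⟩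
  · simp [zero_mem]
  · intro a c _ _ h1 h2
    rw [add_mul]; exact add_mem h1 h2
  · intro a _ h1
    rw [neg_mul]; exact neg_mem h1

lemma genSub_dense (hs : IsSimpleCStarAlgebra A) {b : A} (hb : b ≠ 0) :
    (1 : A) ∈ closure (genSub b : Set A) := by
  have hc : ∀ x, x ∈ (genSub b).topologicalClosure ↔ x ∈ closure (genSub b : Set A) := fun x => Iff.rfl
  let I : TwoSidedIdeal A := TwoSidedIdeal.mk' (closure (genSub b : Set A))
    ((genSub b).topologicalClosure.zero_mem)
    (fun h1 h2 => (genSub b).topologicalClosure.add_mem h1 h2)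
    (fun h1 => (genSub b).topologicalClosure.neg_mem h1)
    (fun {z g} h => map_mem_closure (f := fun g => z * g) (by fun_prop) h
      (fun g hg => genSub_left b z hg))
    (fun {g z} h => map_mem_closure (f := fun g => g * z) (by fun_prop) h
      (fun g hg => genSub_right b z hg))
  have hI : (I : Set A) = closure (genSub b : Set A) := TwoSidedIdeal.coe_mk' ..
  have hbI : b ∈ I := by
    rw [← SetLike.mem_coe, hI]
    exact subset_closure (AddSubgroup.subset_closure ⟨1, 1, by simp⟩)
  rcases hs I (by rw [hI]; exact isClosed_closure) with h | h
  · rw [h, TwoSidedIdeal.mem_bot] at hbI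
    exact absurd hbI hb
  · rw [← hI, h]; trivial

lemma full_of_simple (hs : IsSimpleCStarAlgebra A) {b : A} (hbp : IsProjection b) (hb : b ≠ 0)
    {p : A} (hp : IsProjection p) : ∃ (k : ℕ) (w : Fin k → A), ∑ i, star (w i) * w i = p ∧
      (∀ i, w i * p = w i) ∧ (∀ i, b * w i = w i) := by
  let _ := CStarAlgebra.spectralOrder A
  have _ := CStarAlgebra.spectralOrderedRing A
  have hbs : star b = b := hbp.1
  have hps : star p = p := hp.1
  obtain ⟨g, hg, hg1⟩ := Metric.mem_closure_iff.1 (genSub_dense hs hb) (1/2) (by norm_num)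
  have hP : ∀ g ∈ genSub b, ∃ (k : ℕ) (z : Fin k → A), g + star g ≤ ∑ i, star (z i) * b * z i ∧
      -(g + star g) ≤ ∑ i, star (z i) * b * z i := by
    intro g hg
    refine AddSubgroup.closure_induction (p := fun g _ => ∃ (k : ℕ) (z : Fin k → A),
      g + star g ≤ ∑ i, star (z i) * b * z i ∧ -(g + star g) ≤ ∑ i, star (z i) * b * z i)
      ?_ ?_ ?_ ?_ hg
    · rintro _ ⟨x, y, rfl⟩
      have key : ∀ c : A, 0 ≤ c * b * star c := fun c => by
        have := mul_star_self_nonneg (c * b)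
        rwa [star_mul, hbs, mul_assoc c b, ← mul_assoc b b, hbp.2, ← mul_assoc] at this
      refine ⟨2, ![star x, y], ?_, ?_⟩
      · rw [← sub_nonneg]
        convert key (x - star y) using 1
        simp [Fin.sum_univ_two, hbs, mul_assoc]
        noncomm_ring
      · rw [← sub_nonneg]
        convert key (x + star y) using 1
        simp [Fin.sum_univ_two, hbs, mul_assoc]
        noncomm_ring
    · exact ⟨0, ![], by simp, by simp⟩
    · rintro a c _ _ ⟨k, z, h1, h2⟩ ⟨k', z', h1', h2'⟩
      refine ⟨k + k', Fin.append z z', ?_, ?_⟩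
      · simp only [Fin.sum_univ_add, Fin.append_left, Fin.append_right]
        convert add_le_add h1 h1' using 1
        simp; abel
      · simp only [Fin.sum_univ_add, Fin.append_left, Fin.append_right]
        convert add_le_add h2 h2' using 1
        simp; abel
    · rintro a _ ⟨k, z, h1, h2⟩
      refine ⟨k, z, ?_, ?_⟩
      · convert h2 using 1
        simp; abel
      · convert h1 using 1
        simp; abel
  obtain ⟨k, z, hz, -⟩ := hP g hg
  set G := ∑ i, star (z i) * b * z i with hG
  have hGsa : IsSelfAdjoint G := by
    rw [hG, isSelfAdjoint_iff, star_sum]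
    refine Finset.sum_congr rfl fun i _ => ?_
    simp [hbs, mul_assoc]
  rw [dist_eq_norm] at hg1
  have hpos : ∀ x ∈ spectrum ℝ G, 0 < x := by
    have e : (1 - g) + star (1 - g) ≤ algebraMap ℝ A ‖(1 - g) + star (1 - g)‖ :=
      IsSelfAdjoint.le_algebraMap_norm_self (IsSelfAdjoint.add_star_self _)
    set N := ‖(1 - g) + star (1 - g)‖ with hN
    have hN1 : N < 1 := by
      have := norm_add_le (1 - g) (star (1 - g))
      rw [norm_star] at this
      linarith
    have e2 : algebraMap ℝ A (2 - N) ≤ G := by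
      refine le_trans ?_ hz
      have : algebraMap ℝ A (2 - N) = 2 - algebraMap ℝ A N := by
        rw [map_sub, map_ofNat]
      rw [this, sub_le_comm]
      convert e using 1
      rw [star_sub, star_one, ← one_add_one_eq_two]
      abel
    rw [algebraMap_le_iff_le_spectrum] at e2
    intro x hx
    have := e2 x hx
    linarith
  obtain ⟨R, hR, hR1, -⟩ := invsqrt G hGsa hpos
  have hRs : star R = R := hR
  refine ⟨k, fun i => b * z i * R * p, ?_, ?_, ?_⟩
  · have : ∀ i, star (b * z i * R * p) * (b * z i * R * p) = p * R * (star (z i) * b * z i) * R * p := by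
      intro i
      simp only [star_mul, hbs, hRs, hps]
      calc _ = p * R * (star (z i) * (b * b) * z i) * R * p := by simp only [mul_assoc]
        _ = _ := by rw [hbp.2]
    simp only [this]
    rw [← Finset.sum_mul, ← Finset.sum_mul, ← Finset.mul_sum, ← hG, mul_assoc p R G, mul_assoc p, hR1,
      mul_one, hp.2]
  · intro i; simp only [mul_assoc, hp.2]
  · intro i; simp only [← mul_assoc, hbp.2]

lemma finite_of (hsf : StablyFinite A) {x : A} (hx : star x * x = 1) : x * star x = 1 := by
  have := hsf 1 (Matrix.of fun _ _ => x) (by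
    ext i j
    rw [Subsingleton.elim i j]
    simp [Matrix.mul_apply, Matrix.star_apply, hx])
  have h := congrFun (congrFun this 0) 0
  simpa [Matrix.mul_apply, Matrix.star_apply] using h

lemma compl_eq (hsf : StablyFinite A) {r p q v : A} (hr : IsProjection r) (hp : p = 1 - r)
    (hv : star v * v = p) (hvq : v * star v = q) (hrq : r * q = 0) : q = 1 - r := by
  have hrs : star r = r := hr.1
  have hpp : IsProjection p := by
    subst hp
    refine ⟨by simp [isSelfAdjoint_iff, hrs], ?_⟩
    noncomm_ring [hr.2]
  have hvp : v * p = v := pi_mul hv hpp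
  have hqv : q * v = v := by rw [← hvq, mul_assoc, hv, hvp]
  have hrv : r * v = 0 := by rw [← hqv, ← mul_assoc, hrq, zero_mul]
  have hvr : v * r = 0 := by
    rw [← hvp, hp, mul_assoc, sub_mul, hr.2, one_mul, sub_self, mul_zero]
  have hsvr : star v * r = 0 := by rw [← hrs, ← star_mul, hrv, star_zero]
  have hrsv : r * star v = 0 := by rw [← hrs, ← star_mul, hvr, star_zero]
  have := finite_of hsf (x := v + r) (by
    rw [star_add, hrs, mul_add, add_mul, add_mul, hv, hrv, hsvr, hr.2, hp]; abel)
  rw [star_add, hrs, mul_add, add_mul, add_mul, hvq, hrsv, hvr, hr.2] at this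
  rw [← this]; abel

lemma compl_proj {r p : A} (hr : IsProjection r) (hp : IsProjection p) (h : r * p = 0) :
    IsProjection (1 - r - p) ∧ p * r = 0 := by
  have hrs : star r = r := hr.1
  have hps : star p = p := hp.1
  have h' : p * r = 0 := by
    have := congrArg star h
    simpa [hrs, hps] using this
  refine ⟨⟨by simp [isSelfAdjoint_iff, hrs, hps], ?_⟩, h'⟩
  simp only [mul_sub, sub_mul, hr.2, hp.2, h, h', one_mul, mul_one]
  abel

lemma stepM (hs : IsSimpleCStarAlgebra A) (hAD : AD A) (hsf : StablyFinite A) {r p q : A}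
    (hr : IsProjection r) (hp : IsProjection p) (hq : IsProjection q)
    (hrp : r * p = 0) (hrq : r * q = 0) (hpq : MvNEquiv p q) :
    ∃ γ : ℝ → A, Continuous γ ∧ (∀ t ≤ 0, γ t = 1) ∧ (∀ t, γ t ∈ unitary A) ∧
      (∀ t, γ t * r = r) ∧ (∀ t ≥ 1, γ t * p * star (γ t) = q) := by
  obtain ⟨v, hv, hvq⟩ := hpq
  have hrs : star r = r := hr.1
  by_cases h1 : p = q
  · subst h1
    exact ⟨fun _ => 1, continuous_const, fun _ _ => rfl, fun _ => one_mem _, fun _ => one_mul _,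
      fun _ _ => by simp⟩
  obtain ⟨hb, hpr⟩ := compl_proj hr hp hrp
  obtain ⟨hb', hqr⟩ := compl_proj hr hq hrq
  have hb0 : 1 - r - p ≠ 0 := by
    intro h
    have h2 : p = 1 - r := (sub_eq_zero.1 h).symm
    exact h1 (h2.trans (compl_eq hsf hr h2 hv hvq hrq).symm)
  have hb0' : 1 - r - q ≠ 0 := by
    intro h
    have h2 : q = 1 - r := (sub_eq_zero.1 h).symm
    have := compl_eq (v := star v) hsf hr h2 (by simpa using hvq) (by simpa using hv) hrp
    exact h1 (this.trans h2.symm)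
  obtain ⟨k, w, hw, hwp, hbw⟩ := full_of_simple hs hb hb0 hp
  obtain ⟨k', w', hw', hwp', hbw'⟩ := full_of_simple hs hb' hb0' hq
  have hrb : r * (1 - r - p) = 0 := by simp [mul_sub, hr.2, hrp]
  have hrb' : r * (1 - r - q) = 0 := by simp [mul_sub, hr.2, hrq]
  have hpb : p * (1 - r - p) = 0 := by simp [mul_sub, hp.2, hpr]
  have hqb' : q * (1 - r - q) = 0 := by simp [mul_sub, hq.2, hqr]
  have hrw : ∀ i, r * w i = 0 := fun i => by rw [← hbw, ← mul_assoc, hrb, zero_mul]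
  have hrw' : ∀ i, r * w' i = 0 := fun i => by rw [← hbw', ← mul_assoc, hrb', zero_mul]
  have hpw : ∀ i, p * w i = 0 := fun i => by rw [← hbw, ← mul_assoc, hpb, zero_mul]
  have hpw' : ∀ i, q * w' i = 0 := fun i => by rw [← hbw', ← mul_assoc, hqb', zero_mul]
  have hwr : ∀ i, w i * r = 0 := fun i => by rw [← hwp, mul_assoc, hpr, mul_zero]
  have hwr' : ∀ i, w' i * r = 0 := fun i => by rw [← hwp', mul_assoc, hqr, mul_zero]
  have hvp : v * p = v := pi_mul hv hp
  have hqv : q * v = v := by rw [← hvq, mul_assoc, hv, hvp]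
  have hrv : r * v = 0 := by rw [← hqv, ← mul_assoc, hrq, zero_mul]
  have hvr : v * r = 0 := by rw [← hvp, mul_assoc, hpr, mul_zero]
  have hM : Hom (A := Cr r) ⟨p, (mem_Cr hrs).2 (hrp.trans hpr.symm)⟩
      ⟨q, (mem_Cr hrs).2 (hrq.trans hqr.symm)⟩ := by
    refine L_main (A := Cr r) (AD_Cr hAD hr) (v := ⟨v, (mem_Cr hrs).2 (hrv.trans hvr.symm)⟩)
      ⟨Subtype.ext hp.1, Subtype.ext hp.2⟩ ⟨Subtype.ext hq.1, Subtype.ext hq.2⟩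
      (Subtype.ext hv) (Subtype.ext hvq)
      (fun i => ⟨w i, (mem_Cr hrs).2 ((hrw i).trans (hwr i).symm)⟩)
      (fun i => ⟨w' i, (mem_Cr hrs).2 ((hrw' i).trans (hwr' i).symm)⟩)
      (Subtype.ext ?_) (fun i => Subtype.ext (hwp i)) (fun i => Subtype.ext (hpw i))
      (Subtype.ext ?_) (fun i => Subtype.ext (hwp' i)) (fun i => Subtype.ext (hpw' i))
    · refine Eq.trans ?_ hw; simp
    · refine Eq.trans ?_ hw'; simp
  obtain ⟨W, ⟨c⟩, hW⟩ := hM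
  let y : ℝ → A := fun t => ((c.extend t : unitary (Cr r)) : Cr r)
  have hy : Continuous y := by
    have := c.continuous_extend
    fun_prop
  have hyc : ∀ t, r * y t = y t * r := fun t => (mem_Cr hrs).1 (Subtype.property _)
  have hyu : ∀ t, star (y t) * y t = 1 := fun t =>
    congrArg Subtype.val (Unitary.mem_iff.1 (c.extend t).2).1
  have hyu' : ∀ t, y t * star (y t) = 1 := fun t =>
    congrArg Subtype.val (Unitary.mem_iff.1 (c.extend t).2).2
  have hys : ∀ t, r * star (y t) = star (y t) * r := fun t => by
    have := congrArg star (hyc t)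
    simpa [hrs] using this.symm
  have hy1 : ∀ t ≥ 1, y t * p * star (y t) = q := by
    intro t ht
    have : y t = ((W : Cr r) : A) := by
      simp only [y]; rw [c.extend_of_one_le ht]
    rw [this]
    exact congrArg Subtype.val hW
  have hg : ∀ t, r + (1 - r) * y t = r + y t - y t * r := fun t => by
    rw [sub_mul, one_mul, hyc]; abel
  have hgs : ∀ t, star (r + (1 - r) * y t) = r + star (y t) * (1 - r) := fun t => by
    simp [hrs]
  have hrr : (1 - r) * r = 0 := by rw [sub_mul, hr.2, one_mul, sub_self]
  have hrr' : r * (1 - r) = 0 := by rw [mul_sub, hr.2, mul_one, sub_self]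
  have hr1 : (1 - r) * (1 - r) = 1 - r := by rw [mul_sub, hrr, mul_one, sub_zero]
  have hyc1 : ∀ t, (1 - r) * y t = y t * (1 - r) := fun t => by
    rw [mul_sub, sub_mul, hyc, one_mul, mul_one]
  have hys1 : ∀ t, (1 - r) * star (y t) = star (y t) * (1 - r) := fun t => by
    rw [mul_sub, sub_mul, hys, one_mul, mul_one]
  refine ⟨fun t => r + (1 - r) * y t, by fun_prop, ?_, ?_, ?_, ?_⟩
  · intro t ht
    have : y t = 1 := by
      simp only [y]; rw [c.extend_of_le_zero ht]; rfl
    simp [this]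
  · intro t
    rw [Unitary.mem_iff, hgs]
    constructor
    · calc (r + star (y t) * (1 - r)) * (r + (1 - r) * y t)
          = r * r + r * (1 - r) * y t + star (y t) * ((1 - r) * r)
            + star (y t) * ((1 - r) * (1 - r) * y t) := by noncomm_ring
        _ = r + star (y t) * y t * (1 - r) := by
          rw [hr.2, hrr', hrr, hr1, hyc1]; simp [mul_assoc]
        _ = 1 := by rw [hyu]; simp
    · calc (r + (1 - r) * y t) * (r + star (y t) * (1 - r))
          = r * r + (r * star (y t)) * (1 - r) + ((1 - r) * y t) * r
            + (1 - r) * (y t * star (y t)) * (1 - r) := by noncomm_ring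
        _ = 1 := by
          rw [hr.2, hys, hyu', hyc1, mul_assoc, hrr', mul_assoc, hrr, mul_one, hr1]; simp
  · intro t
    beta_reduce
    rw [hyc1, add_mul, mul_assoc, hrr, hr.2]; simp
  · intro t ht
    have e1 : (r + (1 - r) * y t) * p = y t * p := by
      rw [hyc1, add_mul, hrp, mul_assoc, sub_mul, hrp]; simp
    have e2 : p * star (r + (1 - r) * y t) = p * star (y t) := by
      rw [hgs, ← hys1, mul_add, hpr, ← mul_assoc, mul_sub, hpr]; simp
    rw [e1, mul_assoc, ← hy1 t ht]
    have : p = p * p := hp.2.symm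
    calc y t * (p * star (r + (1 - r) * y t)) = y t * (p * star (y t)) := by rw [e2]
      _ = _ := by rw [mul_assoc]

end IUP

end

section
set_option linter.unusedSimpArgs false
namespace IUP
variable {A : Type*} [CStarAlgebra A]

lemma psum_mul {q : ℕ → A} (hq : ∀ i, IsProjection (q i)) (ho : ∀ i j, i ≠ j → q i * q j = 0)
    {l n : ℕ} (h : l ≤ n) :
    (∑ i ∈ Finset.range n, q i) * (∑ i ∈ Finset.range l, q i) = ∑ i ∈ Finset.range l, q i := by
  rw [Finset.mul_sum]
  refine Finset.sum_congr rfl fun j hj => ?_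
  rw [Finset.sum_mul, Finset.sum_eq_single j]
  · exact (hq j).2
  · intro i _ hij; exact ho i j hij
  · intro hn
    exact absurd (Finset.mem_range.2 ((Finset.mem_range.1 hj).trans_le h)) hn

lemma psum_proj {q : ℕ → A} (hq : ∀ i, IsProjection (q i)) (ho : ∀ i j, i ≠ j → q i * q j = 0)
    (n : ℕ) : IsProjection (∑ i ∈ Finset.range n, q i) := by
  refine ⟨?_, psum_mul hq ho le_rfl⟩
  rw [isSelfAdjoint_iff, star_sum]
  exact Finset.sum_congr rfl fun i _ => (hq i).1

lemma psum_orth {q : ℕ → A} (ho : ∀ i j, i ≠ j → q i * q j = 0)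
    (n : ℕ) : (∑ i ∈ Finset.range n, q i) * q n = 0 := by
  rw [Finset.sum_mul]
  exact Finset.sum_eq_zero fun i hi => ho i n (Finset.mem_range.1 hi).ne

/-- A path which is good up to stage `n`. -/
structure Good (p q : ℕ → A) (n : ℕ) (G : ℝ → A) : Prop where
  cont : Continuous G
  unit : ∀ t, G t ∈ unitary A
  zero : G 0 = 1
  conj : ∀ l ≤ n, ∀ t : ℝ, (l : ℝ) ≤ t →
    G t * (∑ i ∈ Finset.range l, p i) * star (G t) = ∑ i ∈ Finset.range l, q i

lemma extend_good (hs : IsSimpleCStarAlgebra A) (hAD : AD A) (hsf : StablyFinite A) {p q : ℕ → A}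
    (hp : ∀ i, IsProjection (p i)) (hq : ∀ i, IsProjection (q i))
    (horthp : ∀ i j, i ≠ j → p i * p j = 0) (horthq : ∀ i j, i ≠ j → q i * q j = 0)
    (hmvn : ∀ i, MvNEquiv (p i) (q i)) (n : ℕ) (G : ℝ → A) (hG : Good p q n G) :
    ∃ G' : ℝ → A, Good p q (n + 1) G' ∧ ∀ t : ℝ, t ≤ n → G' t = G t := by
  set U := G n with hU
  have hUu := Unitary.mem_iff.1 (hG.unit n)
  rw [← hU] at hUu
  obtain ⟨u1, u2⟩ := hUu
  set P := fun l => ∑ i ∈ Finset.range l, p i with hPdef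
  set Q := fun l => ∑ i ∈ Finset.range l, q i with hQdef
  have hUP : U * P n * star U = Q n := hG.conj n le_rfl n le_rfl
  have hmul : ∀ a b : A, (U * a * star U) * (U * b * star U) = U * (a * b) * star U := by
    intro a b
    calc _ = U * a * (star U * U) * b * star U := by simp only [mul_assoc]
      _ = _ := by rw [u1]; simp only [mul_assoc, mul_one]
  have hp' : IsProjection (U * p n * star U) := by
    refine ⟨?_, by rw [hmul, (hp n).2]⟩
    rw [isSelfAdjoint_iff]
    have : star (p n) = p n := (hp n).1
    simp [this, mul_assoc]
  have hQp : Q n * (U * p n * star U) = 0 := by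
    rw [← hUP, hmul, psum_orth horthp]; simp
  have hm : MvNEquiv (U * p n * star U) (q n) := by
    obtain ⟨v, hv, hvq⟩ := hmvn n
    refine ⟨v * star U, ?_, ?_⟩
    · rw [← hv]; simp [mul_assoc]
    · rw [← hvq, star_mul, star_star]
      calc _ = v * (star U * U) * star v := by simp only [mul_assoc]
        _ = _ := by rw [u1, mul_one]
  obtain ⟨γ, hγc, hγ0, hγu, hγr, hγ1⟩ := stepM hs hAD hsf (psum_proj hq horthq n) hp' (hq n) hQp
    (psum_orth horthq n) hm
  have hlow : ∀ t : ℝ, t ≤ n → γ (t - n) * G (min t n) = G t := fun t ht => by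
    rw [hγ0 _ (by linarith), one_mul, min_eq_left ht]
  have hγQ : ∀ l ≤ n, ∀ t, γ t * Q l = Q l := fun l hl t => by
    have h1 : Q n * Q l = Q l := psum_mul hq horthq hl
    rw [← h1, ← mul_assoc, hγr]
  have hγQs : ∀ l ≤ n, ∀ t, Q l * star (γ t) = Q l := fun l hl t => by
    have h1 : star (Q l) = Q l := (psum_proj hq horthq l).1
    have := congrArg star (hγQ l hl t)
    rwa [star_mul, h1] at this
  refine ⟨fun t => γ (t - n) * G (min t n), ⟨?_, ?_, ?_, ?_⟩, hlow⟩
  · have := hG.cont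
    fun_prop
  · exact fun t => mul_mem (hγu _) (hG.unit _)
  · exact (hlow 0 (Nat.cast_nonneg n)).trans hG.zero
  · intro l hl t ht
    have expand : ∀ a b x : A, (a * b) * x * star (a * b) = a * (b * x * star b) * star a := by
      intro a b x; simp only [star_mul, mul_assoc]
    rw [expand]
    rcases Nat.lt_or_ge n l with h | h
    · obtain rfl : l = n + 1 := by omega
      push_cast at ht
      rw [min_eq_right (by linarith), ← hU, Finset.sum_range_succ, Finset.sum_range_succ, mul_add,
        add_mul, mul_add, add_mul, hγ1 _ (by linarith)]
      congr 1
      rw [show U * (∑ i ∈ Finset.range n, p i) * star U = Q n from hUP, hγQ n le_rfl,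
        hγQs n le_rfl]
    · rw [hG.conj l h (min t n) (le_min ht (by exact_mod_cast h))]
      change γ (t - n) * Q l * star _ = Q l
      rw [hγQ l h, hγQs l h]

lemma exists_path (hs : IsSimpleCStarAlgebra A) (hAD : AD A) (hsf : StablyFinite A) {p q : ℕ → A}
    (hp : ∀ i, IsProjection (p i)) (hq : ∀ i, IsProjection (q i))
    (horthp : ∀ i j, i ≠ j → p i * p j = 0) (horthq : ∀ i j, i ≠ j → q i * q j = 0)
    (hmvn : ∀ i, MvNEquiv (p i) (q i)) :
    ∃ g : ℝ → A, Continuous g ∧ g 0 = 1 ∧ (∀ t, g t ∈ unitary A) ∧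
      ∀ l : ℕ, ∀ t : ℝ, (l : ℝ) ≤ t →
        g t * (∑ i ∈ Finset.range l, p i) * star (g t) = ∑ i ∈ Finset.range l, q i := by
  choose! F hF1 hF2 using extend_good hs hAD hsf hp hq horthp horthq hmvn
  let G : ℕ → ℝ → A := fun n => Nat.rec (fun _ => 1) F n
  have hGs : ∀ n, G (n + 1) = F n (G n) := fun n => rfl
  have hG : ∀ n, Good p q n (G n) := by
    intro n
    induction n with
    | zero =>
      refine ⟨continuous_const, fun _ => one_mem _, rfl, ?_⟩
      intro l hl t _
      obtain rfl : l = 0 := by omega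
      simp
    | succ n ih => rw [hGs]; exact hF1 n _ ih
  have hst : ∀ n m : ℕ, n ≤ m → ∀ t : ℝ, t ≤ n → G m t = G n t := by
    intro n m h
    induction m, h using Nat.le_induction with
    | base => intro t _; rfl
    | succ m hm ih =>
      intro t ht
      rw [hGs, hF2 m _ (hG m) t (ht.trans (by exact_mod_cast hm)), ih t ht]
  have hg : ∀ n : ℕ, ∀ t : ℝ, t ≤ n → G ⌈t⌉₊ t = G n t := fun n t ht =>
    (hst _ _ (Nat.ceil_le.2 ht) t (Nat.le_ceil t)).symm
  refine ⟨fun t => G ⌈t⌉₊ t, ?_, ?_, fun t => (hG _).unit t, ?_⟩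
  · rw [continuous_iff_continuousAt]
    intro t
    obtain ⟨n, hn⟩ := exists_nat_gt t
    refine ((hG n).cont.continuousAt).congr ?_
    filter_upwards [Iio_mem_nhds hn] with s hs
    exact (hg n s (le_of_lt hs)).symm
  · exact (hG _).zero
  · intro l t ht
    exact (hG _).conj l (by exact_mod_cast ht.trans (Nat.le_ceil t)) t ht

lemma final (hs : IsSimpleCStarAlgebra A) (hAD : AD A) (hsf : StablyFinite A) {p q : ℕ → A}
    (hp : ∀ i, IsProjection (p i)) (hq : ∀ i, IsProjection (q i))
    (horthp : ∀ i j, i ≠ j → p i * p j = 0) (horthq : ∀ i j, i ≠ j → q i * q j = 0)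
    (hmvn : ∀ i, MvNEquiv (p i) (q i)) :
    ∃ u : ℝ → A, ContinuousOn u (Set.Ico 0 1) ∧ u 0 = 1 ∧
      (∀ t ∈ Set.Ico (0 : ℝ) 1, u t ∈ unitary A) ∧
      ∀ l : ℕ, ∀ t ∈ Set.Ico (0 : ℝ) 1, 1 - ((1 : ℝ) / 2) ^ l ≤ t →
        u t * (∑ i ∈ Finset.range l, p i) * star (u t) = ∑ i ∈ Finset.range l, q i := by
  obtain ⟨g, hgc, hg0, hgu, hgl⟩ := exists_path hs hAD hsf hp hq horthp horthq hmvn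
  refine ⟨fun t => g (-Real.log (1 - t) / Real.log 2), ?_, by simpa using hg0,
    fun t _ => hgu _, ?_⟩
  · refine hgc.comp_continuousOn ?_
    refine ContinuousOn.div_const (ContinuousOn.neg (ContinuousOn.log (by fun_prop) ?_)) _
    intro t ht
    have := ht.2
    exact (by linarith : (0 : ℝ) < 1 - t).ne'
  · intro l t ht hl
    refine hgl l _ ?_
    have h2 : 0 < Real.log 2 := Real.log_pos (by norm_num)
    rw [le_div_iff₀ h2]
    have h3 : Real.log (1 - t) ≤ Real.log ((1 / 2 : ℝ) ^ l) :=
      Real.log_le_log (by linarith [ht.2]) (by linarith)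
    rw [Real.log_pow, one_div, Real.log_inv] at h3
    linarith

end IUP

end



/-- The inductive unitary-path construction in the proof of Theorem 1.1:
given mutually orthogonal sequences of projections `pᵢ`, `qᵢ` with `pᵢ ∼ qᵢ`
(Murray–von Neumann) in a unital simple approximately divisible stably finite C*-algebra,
there is a norm-continuous `u : [0,1) → U(A)` with `u 0 = 1` and
`uₜ (p₁ + ⋯ + p_l) uₜ* = q₁ + ⋯ + q_l` whenever `t ≥ s_l = 1 - 2⁻ˡ`. -/
theorem inductive_unitary_path {A : Type*} [CStarAlgebra A]
    (hsimple : IsSimpleCStarAlgebra A)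
    (hdiv : ApproximatelyDivisible A)
    (hsf : StablyFinite A)
    (p q : ℕ → A) (hp : ∀ i, IsProjection (p i)) (hq : ∀ i, IsProjection (q i))
    (horthp : ∀ i j, i ≠ j → p i * p j = 0) (horthq : ∀ i j, i ≠ j → q i * q j = 0)
    (hmvn : ∀ i, MvNEquiv (p i) (q i)) :
    ∃ u : ℝ → A, ContinuousOn u (Set.Ico 0 1) ∧ u 0 = 1 ∧
      (∀ t ∈ Set.Ico (0 : ℝ) 1, u t ∈ unitary A) ∧
      ∀ l : ℕ, ∀ t ∈ Set.Ico (0 : ℝ) 1, 1 - ((1 : ℝ) / 2) ^ l ≤ t →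
        u t * (∑ i ∈ Finset.range l, p i) * star (u t) = ∑ i ∈ Finset.range l, q i := by
  exact IUP.final hsimple (IUP.AD_of hdiv) hsf hp hq horthp horthq hmvn
end
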